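/- arXiv:1311.3258 — 3 statements merged into one kernel-verified Lean document; each statement's English description precedes it below -/
import Mathlib

section
/- Let I be an at most countable index set and A = (a_{ij})_{i,j∈I} a real matrix. Then ĝ_0(A) = n̂_0^- ⊕ ĥ ⊕ n̂_0^+ as a direct sum of vector spaces, where ĥ = span{h_{ij} : i,j∈I} is an abelian subalgebra with basis the set of those h_{ij} for which the i-th and j-th columns of A are equal; n̂_0^+ (the subalgebra generated by the e_i) is the free Lie algebra on {e_i}_{i∈I}, and n̂_0^- (the subalgebra generated by the f_i) is the free Lie algebra on {f_i}_{i∈I}. Moreover the set {e_i, f_i : i∈I} ∪ {h_{ij} : (i,j) ∈ S} is linearly independent in ĝ_0(A), where S = {(i,j) ∈ I×I : a_{ki} = a_{kj} for all k ∈ I}. -/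
/-!
Statement 3: triangular decomposition `ĝ₀(A) = n̂₀⁻ ⊕ ĥ ⊕ n̂₀⁺`, with `ĥ` abelian with
basis the `h i j` for which the `i`-th and `j`-th columns of `A` agree, `n̂₀±` free, and
the stated linear independence.
-/

open FreeLieAlgebra
open scoped Classical

/-- The generators of `ĝ₀(A)`: `h i j`, `e i`, `f i` for `i, j ∈ I`. -/
inductive HatGen (I : Type) : Type
  | h (i j : I)
  | e (i : I)
  | f (i : I)

variable (I : Type) (A : I → I → ℝ)

/-- The defining relation elements (R1')-(R3') inside the free Lie algebra. -/
def hatRels : Set (FreeLieAlgebra ℝ (HatGen I)) :=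
  {x | ∃ i j k l : I, x = ⁅of ℝ (HatGen.h i j), of ℝ (HatGen.h k l)⁆} ∪
  {x | ∃ i j k : I, x = ⁅of ℝ (HatGen.h i j), of ℝ (HatGen.e k)⁆ -
      (if i = j then A i k else 0) • of ℝ (HatGen.e k)} ∪
  {x | ∃ i j k : I, x = ⁅of ℝ (HatGen.h i j), of ℝ (HatGen.f k)⁆ +
      (if i = j then A i k else 0) • of ℝ (HatGen.f k)} ∪
  {x | ∃ i j : I, x = ⁅of ℝ (HatGen.e i), of ℝ (HatGen.f j)⁆ - of ℝ (HatGen.h i j)}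

/-- `ĝ₀(A)`, the quotient of the free Lie algebra by the ideal generated by (R1')-(R3'). -/
def hatGZero := FreeLieAlgebra ℝ (HatGen I) ⧸
  LieSubmodule.lieSpan ℝ (FreeLieAlgebra ℝ (HatGen I)) (hatRels I A)

noncomputable instance : LieRing (hatGZero I A) := by unfold hatGZero; infer_instance
noncomputable instance : LieAlgebra ℝ (hatGZero I A) := by unfold hatGZero; infer_instance

/-- The image of a free generator in `ĝ₀(A)`. -/
noncomputable def hatGen (x : HatGen I) : hatGZero I A :=
  LieSubmodule.Quotient.mk' _ (of ℝ x)

noncomputable def hatE (i : I) : hatGZero I A := hatGen I A (HatGen.e i)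
noncomputable def hatF (i : I) : hatGZero I A := hatGen I A (HatGen.f i)
noncomputable def hatH (i j : I) : hatGZero I A := hatGen I A (HatGen.h i j)


/-- The subspace `ĥ`, the span of the `h i j`. -/
noncomputable def hatHPart : Submodule ℝ (hatGZero I A) :=
  Submodule.span ℝ {x | ∃ i j : I, x = hatH I A i j}

/-- The subalgebra generated by the `eᵢ`. -/
noncomputable def hatNPlus : LieSubalgebra ℝ (hatGZero I A) :=
  LieSubalgebra.lieSpan ℝ _ (Set.range (hatE I A))

/-- The subalgebra generated by the `fᵢ`. -/
noncomputable def hatNMinus : LieSubalgebra ℝ (hatGZero I A) :=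
  LieSubalgebra.lieSpan ℝ _ (Set.range (hatF I A))

/-- The canonical map from the free Lie algebra on `I` sending `i` to `eᵢ`. -/
noncomputable def hatECanon : FreeLieAlgebra ℝ I →ₗ⁅ℝ⁆ hatGZero I A :=
  FreeLieAlgebra.lift ℝ (hatE I A)

/-- The canonical map from the free Lie algebra on `I` sending `i` to `fᵢ`. -/
noncomputable def hatFCanon : FreeLieAlgebra ℝ I →ₗ⁅ℝ⁆ hatGZero I A :=
  FreeLieAlgebra.lift ℝ (hatF I A)

/-- The set of pairs `(i,j)` for which the `i`-th and `j`-th columns of `A` agree. -/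
def colEq : Set (I × I) := {p | ∀ k : I, A k p.1 = A k p.2}

/-- The combined family `{eᵢ} ∪ {fᵢ} ∪ {h i j : (i,j) ∈ S}`. -/
noncomputable def combinedFamily : (I ⊕ I ⊕ colEq I A) → hatGZero I A
  | Sum.inl i => hatE I A i
  | Sum.inr (Sum.inl i) => hatF I A i
  | Sum.inr (Sum.inr p) => hatH I A p.1.1 p.1.2

attribute [local instance] LieRing.ofAssociativeRing

theorem FreeLieAlgebra.eq_top_of_forall_of_mem {R X : Type*} [CommRing R]
    (K : LieSubalgebra R (FreeLieAlgebra R X)) (hK : ∀ x, of R x ∈ K) : K = ⊤ := by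
  have h : K.incl.comp (FreeLieAlgebra.lift R fun x => (⟨of R x, hK x⟩ : K)) = 1 := by
    ext x
    simp
  refine eq_top_iff.2 fun x _ => ?_
  have hx := LieHom.congr_fun h x
  rw [LieHom.one_apply] at hx
  rw [← hx]
  exact Subtype.coe_prop _

theorem FreeLieAlgebra.range_lift {R X L : Type*} [CommRing R] [LieRing L] [LieAlgebra R L]
    (g : X → L) :
    (FreeLieAlgebra.lift R g).range = LieSubalgebra.lieSpan R L (Set.range g) := by
  refine le_antisymm ?_ ?_
  · rintro _ ⟨x, rfl⟩
    have h := eq_top_of_forall_of_mem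
      ((LieSubalgebra.lieSpan R L (Set.range g)).comap (FreeLieAlgebra.lift R g))
      fun x => LieSubalgebra.subset_lieSpan ⟨x, by simp⟩
    exact (h ▸ LieSubalgebra.mem_top x :
      x ∈ (LieSubalgebra.lieSpan R L (Set.range g)).comap (FreeLieAlgebra.lift R g))
  · rw [LieSubalgebra.lieSpan_le]
    rintro _ ⟨x, rfl⟩
    exact ⟨of R x, by simp⟩

/-- The quotient map onto `ĝ₀(A)`. -/
noncomputable def hatMk : FreeLieAlgebra ℝ (HatGen I) →ₗ⁅ℝ⁆ hatGZero I A where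
  toLinearMap := (LieSubmodule.Quotient.mk'
    (LieSubmodule.lieSpan ℝ (FreeLieAlgebra ℝ (HatGen I)) (hatRels I A))).toLinearMap
  map_lie' := rfl

theorem hatMk_surjective : Function.Surjective (hatMk I A) := Quot.mk_surjective

theorem hatMk_of (x : HatGen I) : hatMk I A (of ℝ x) = hatGen I A x := rfl

theorem hatMk_eq_zero {x : FreeLieAlgebra ℝ (HatGen I)} (hx : x ∈ hatRels I A) :
    hatMk I A x = 0 :=
  (LieSubmodule.Quotient.mk_eq_zero _).2 (LieSubmodule.subset_lieSpan hx)

theorem hatH_lie_hatH (i j k l : I) : ⁅hatH I A i j, hatH I A k l⁆ = 0 := by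
  have := hatMk_eq_zero I A (.inl (.inl (.inl ⟨i, j, k, l, rfl⟩)))
  rwa [LieHom.map_lie] at this

theorem hatH_lie_hatE (i j k : I) :
    ⁅hatH I A i j, hatE I A k⁆ = (if i = j then A i k else 0) • hatE I A k := by
  have := hatMk_eq_zero I A (.inl (.inl (.inr ⟨i, j, k, rfl⟩)))
  rw [map_sub, LieHom.map_lie, map_smul] at this
  exact sub_eq_zero.1 this

theorem hatH_lie_hatF (i j k : I) :
    ⁅hatH I A i j, hatF I A k⁆ = -((if i = j then A i k else 0) • hatF I A k) := by
  have := hatMk_eq_zero I A (.inl (.inr ⟨i, j, k, rfl⟩))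
  rw [map_add, LieHom.map_lie, map_smul] at this
  exact eq_neg_of_add_eq_zero_left this

theorem hatE_lie_hatF (i j : I) : ⁅hatE I A i, hatF I A j⁆ = hatH I A i j := by
  have := hatMk_eq_zero I A (.inr ⟨i, j, rfl⟩)
  rw [map_sub, LieHom.map_lie] at this
  exact sub_eq_zero.1 this

/-- The universal property of `ĝ₀(A)`. -/
theorem hatGZero_exists_lift {M : Type*} [LieRing M] [LieAlgebra ℝ M] (h : I → I → M)
    (e f : I → M) (hh : ∀ i j k l, ⁅h i j, h k l⁆ = 0)
    (he : ∀ i j k, ⁅h i j, e k⁆ = (if i = j then A i k else 0) • e k)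
    (hf : ∀ i j k, ⁅h i j, f k⁆ = -((if i = j then A i k else 0) • f k))
    (hef : ∀ i j, ⁅e i, f j⁆ = h i j) :
    ∃ φ : hatGZero I A →ₗ⁅ℝ⁆ M, (∀ i j, φ (hatH I A i j) = h i j) ∧
      (∀ i, φ (hatE I A i) = e i) ∧ ∀ i, φ (hatF I A i) = f i := by
  let g : HatGen I → M := fun x => match x with
    | .h i j => h i j
    | .e i => e i
    | .f i => f i
  let ψ := FreeLieAlgebra.lift ℝ g
  have hψ : ∀ x, ψ (of ℝ x) = g x := fun x => lift_of_apply g x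
  have hle : LieSubmodule.lieSpan ℝ (FreeLieAlgebra ℝ (HatGen I)) (hatRels I A) ≤ ψ.ker := by
    rw [LieSubmodule.lieSpan_le]
    rintro x (((⟨i, j, k, l, rfl⟩ | ⟨i, j, k, rfl⟩) | ⟨i, j, k, rfl⟩) | ⟨i, j, rfl⟩) <;>
      simp only [SetLike.mem_coe, LieHom.mem_ker, map_sub, map_add, map_smul, LieHom.map_lie, hψ]
    · exact hh i j k l
    · exact sub_eq_zero.2 (he i j k)
    · exact add_eq_zero_iff_eq_neg.2 (hf i j k)
    · exact sub_eq_zero.2 (hef i j)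
  let φ : hatGZero I A →ₗ[ℝ] M := Submodule.liftQ
    (LieSubmodule.lieSpan ℝ (FreeLieAlgebra ℝ (HatGen I)) (hatRels I A)).toSubmodule
    ψ.toLinearMap fun x hx => hle hx
  have hφ : ∀ x, φ (hatMk I A x) = ψ x := fun x => rfl
  refine ⟨{ φ with map_lie' := ?_ }, fun i j => hψ _, fun i => hψ _, fun i => hψ _⟩
  intro x y
  obtain ⟨x, rfl⟩ := hatMk_surjective I A x
  obtain ⟨y, rfl⟩ := hatMk_surjective I A y
  change φ ⁅hatMk I A x, hatMk I A y⁆ = ⁅φ (hatMk I A x), φ (hatMk I A y)⁆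
  rw [← LieHom.map_lie, hφ, hφ, hφ, LieHom.map_lie]

theorem hatGZero_eq_top (K : LieSubalgebra ℝ (hatGZero I A)) (hE : ∀ i, hatE I A i ∈ K)
    (hF : ∀ i, hatF I A i ∈ K) : K = ⊤ := by
  have h := FreeLieAlgebra.eq_top_of_forall_of_mem (K.comap (hatMk I A)) fun x => by
    cases x with
    | h i j =>
      change hatH I A i j ∈ K
      rw [← hatE_lie_hatF]
      exact K.lie_mem (hE i) (hF j)
    | e i => exact hE i
    | f i => exact hF i
  refine eq_top_iff.2 fun x _ => ?_
  obtain ⟨x, rfl⟩ := hatMk_surjective I A x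
  exact (h ▸ LieSubalgebra.mem_top x : x ∈ K.comap (hatMk I A))

theorem hatH_eq_zero (i j : I) (h : (i, j) ∉ colEq I A) : hatH I A i j = 0 := by
  obtain ⟨k, hk⟩ := not_forall.1 h
  have h0 := hatH_lie_hatH I A k k i j
  rw [← hatE_lie_hatF I A i j, leibniz_lie, hatH_lie_hatE, hatH_lie_hatF, if_pos rfl, if_pos rfl,
    smul_lie, lie_neg, lie_smul, ← sub_eq_add_neg, ← sub_smul, smul_eq_zero] at h0
  exact (hatE_lie_hatF I A i j).symm.trans (h0.resolve_left (sub_ne_zero.2 hk))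

section FreeLie

/-- The operator `(v, c) ↦ (⁅x, v⁆ + c • y, 0)`. -/
noncomputable def affineAd {L : Type*} [LieRing L] [LieAlgebra ℝ L] (x y : L) :
    Module.End ℝ (L × ℝ) :=
  LinearMap.prod
    ((LieAlgebra.ad ℝ L x).coprod (LinearMap.toSpanSingleton ℝ L y)) 0

theorem affineAd_apply {L : Type*} [LieRing L] [LieAlgebra ℝ L] (x y : L) (p : L × ℝ) :
    affineAd x y p = (⁅x, p.1⁆ + p.2 • y, 0) := rfl

/-- The representation of the free Lie algebra on `FreeLieAlgebra ℝ X × ℝ` that extends the adjoint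
representation by the Euler derivation. -/
noncomputable def eulerRep (X : Type*) :
    FreeLieAlgebra ℝ X →ₗ⁅ℝ⁆ Module.End ℝ (FreeLieAlgebra ℝ X × ℝ) :=
  FreeLieAlgebra.lift ℝ fun x => affineAd (of ℝ x) (of ℝ x)

/-- The Euler derivation of the free Lie algebra, which fixes every generator. -/
noncomputable def eulerDer (X : Type*) : Module.End ℝ (FreeLieAlgebra ℝ X) :=
  LinearMap.fst ℝ _ _ ∘ₗ
    LinearMap.applyₗ ((0, 1) : FreeLieAlgebra ℝ X × ℝ) ∘ₗ (eulerRep X).toLinearMap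

theorem eulerDer_apply {X : Type*} (u : FreeLieAlgebra ℝ X) :
    eulerDer X u = (eulerRep X u (0, 1)).1 := rfl

theorem eulerDer_of {X : Type*} (x : X) : eulerDer X (of ℝ x) = of ℝ x := by
  simp [eulerDer_apply, eulerRep, affineAd_apply]

theorem eulerRep_apply {X : Type*} (u : FreeLieAlgebra ℝ X) (p : FreeLieAlgebra ℝ X × ℝ) :
    eulerRep X u p = (⁅u, p.1⁆ + p.2 • eulerDer X u, 0) := by
  let K : LieSubalgebra ℝ (FreeLieAlgebra ℝ X) :=
    { carrier := {u | ∀ p, eulerRep X u p = (⁅u, p.1⁆ + p.2 • eulerDer X u, 0)}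
      zero_mem' := fun p => by simp [Prod.mk_zero_zero]
      add_mem' := fun {u v} hu hv p => by
        rw [map_add, LinearMap.add_apply, hu, hv, map_add, Prod.mk_add_mk, add_lie, smul_add,
          add_zero, add_add_add_comm]
      smul_mem' := fun c u hu p => by
        rw [map_smul, LinearMap.smul_apply, hu, map_smul, Prod.smul_mk, smul_lie, smul_add,
          smul_zero, smul_comm]
      lie_mem' := fun {u v} hu hv p => by
        have hD : eulerDer X ⁅u, v⁆ = ⁅u, eulerDer X v⁆ - ⁅v, eulerDer X u⁆ := by
          rw [eulerDer_apply, LieHom.map_lie, LieRing.of_associative_ring_bracket]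
          simp [hu _, hv _]
        rw [hD, LieHom.map_lie, LieRing.of_associative_ring_bracket]
        simp only [LinearMap.sub_apply, Module.End.mul_apply, hu _, hv _, Prod.mk_sub_mk, lie_lie,
          lie_add, lie_smul, smul_sub, zero_smul, sub_zero, add_zero]
        congr 1
        abel }
  have h := eq_top_of_forall_of_mem K fun x p => by
    rw [eulerDer_of]
    simp [eulerRep, affineAd_apply]
  exact (h ▸ LieSubalgebra.mem_top u : u ∈ K) p

theorem eulerDer_lie {X : Type*} (u v : FreeLieAlgebra ℝ X) :
    eulerDer X ⁅u, v⁆ = ⁅eulerDer X u, v⁆ + ⁅u, eulerDer X v⁆ := by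
  rw [eulerDer_apply, LieHom.map_lie, LieRing.of_associative_ring_bracket]
  simp only [LinearMap.sub_apply, Module.End.mul_apply, eulerRep_apply, Prod.mk_sub_mk]
  rw [← lie_skew v]
  simp [sub_eq_add_neg, add_comm]

theorem iSup_eigenspace_eulerDer (X : Type*) :
    ⨆ n : ℕ, (eulerDer X).eigenspace ((n : ℝ) + 1) = ⊤ := by
  let S : Submodule ℝ (FreeLieAlgebra ℝ X) := ⨆ n : ℕ, (eulerDer X).eigenspace ((n : ℝ) + 1)
  let K : LieSubalgebra ℝ (FreeLieAlgebra ℝ X) :=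
    { S with
      lie_mem' := fun {u v} hu hv => by
        change ⁅u, v⁆ ∈ S
        refine Submodule.iSup_induction _ (motive := fun u => ⁅u, v⁆ ∈ S) hu (fun n u hu => ?_)
          (by simp) fun u w hu hw => by rw [add_lie]; exact S.add_mem hu hw
        refine Submodule.iSup_induction _ (motive := fun v => ⁅u, v⁆ ∈ S) hv (fun m v hv => ?_)
          (by simp) fun v w hv hw => by rw [lie_add]; exact S.add_mem hv hw
        refine Submodule.mem_iSup_of_mem (n + m + 1) ?_
        rw [Module.End.mem_eigenspace_iff] at hu hv ⊢
        rw [eulerDer_lie, hu, hv, smul_lie, lie_smul, ← add_smul]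
        congr 1
        push_cast
        ring }
  have h := eq_top_of_forall_of_mem K fun x => by
    refine Submodule.mem_iSup_of_mem 0 ?_
    rw [Module.End.mem_eigenspace_iff, eulerDer_of]
    simp
  refine eq_top_iff.2 fun u _ => ?_
  exact (h ▸ LieSubalgebra.mem_top u : u ∈ K)

theorem eulerDer_injective (X : Type*) : Function.Injective (eulerDer X) := by
  rw [injective_iff_map_eq_zero]
  intro u hu
  refine Submodule.disjoint_def.1 ((eulerDer X).eigenspaces_iSupIndep 0) u ?_ ?_
  · rw [Module.End.mem_eigenspace_iff, hu, zero_smul]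
  · refine (?_ : (⨆ n : ℕ, (eulerDer X).eigenspace ((n : ℝ) + 1)) ≤ _)
      (iSup_eigenspace_eulerDer X ▸ Submodule.mem_top)
    exact iSup_le fun n => le_iSup₂_of_le ((n : ℝ) + 1) (by positivity) le_rfl

theorem eq_zero_of_eulerRep_apply_eq_zero {X : Type*} {u : FreeLieAlgebra ℝ X}
    (h : eulerRep X u (0, 1) = 0) : u = 0 :=
  eulerDer_injective X (by rw [eulerDer_apply, h, map_zero, Prod.fst_zero])

end FreeLie

section Words

variable {X : Type*}

/-- Left multiplication by the letter `x` on the span of the words in `X`. -/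
noncomputable def consOp (x : X) : Module.End ℝ (List X →₀ ℝ) :=
  Finsupp.lmapDomain ℝ ℝ (List.cons x)

theorem consOp_single (x : X) (w : List X) (c : ℝ) :
    consOp x (.single w c) = .single (x :: w) c := by
  simp [consOp, Finsupp.mapDomain_single]

/-- The action of the free Lie algebra on words by left multiplication. -/
noncomputable def wordRep (X : Type*) : FreeLieAlgebra ℝ X →ₗ⁅ℝ⁆ Module.End ℝ (List X →₀ ℝ) :=
  FreeLieAlgebra.lift ℝ consOp

/-- Right-normed bracketing of words. -/
noncomputable def rightNormed (X : Type*) : (List X →₀ ℝ) →ₗ[ℝ] FreeLieAlgebra ℝ X × ℝ :=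
  Finsupp.linearCombination ℝ
    (List.foldr (fun x p => eulerRep X (of ℝ x) p) ((0 : FreeLieAlgebra ℝ X), (1 : ℝ)))

theorem rightNormed_wordRep (u : FreeLieAlgebra ℝ X) (v : List X →₀ ℝ) :
    rightNormed X (wordRep X u v) = eulerRep X u (rightNormed X v) := by
  let K : LieSubalgebra ℝ (FreeLieAlgebra ℝ X) :=
    { carrier := {u | ∀ v, rightNormed X (wordRep X u v) = eulerRep X u (rightNormed X v)}
      zero_mem' := fun v => by simp
      add_mem' := fun {u₁ u₂} h₁ h₂ v => by simp [h₁ v, h₂ v]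
      smul_mem' := fun c u h v => by simp [h v]
      lie_mem' := fun {u₁ u₂} h₁ h₂ v => by
        simp [LieRing.of_associative_ring_bracket, h₁ _, h₂ _] }
  have h := eq_top_of_forall_of_mem K fun x v => by
    induction v using Finsupp.induction_linear with
    | zero => simp
    | add v w hv hw => simp only [map_add, hv, hw]
    | single w c =>
      rw [wordRep, lift_of_apply, consOp_single]
      simp [rightNormed, Finsupp.linearCombination_single]
  exact (h ▸ LieSubalgebra.mem_top u : u ∈ K) v

theorem eq_zero_of_wordRep_apply_eq_zero {u : FreeLieAlgebra ℝ X}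
    (h : wordRep X u (.single [] 1) = 0) : u = 0 := by
  refine eq_zero_of_eulerRep_apply_eq_zero ?_
  have h' := rightNormed_wordRep u (.single [] 1)
  rw [h, map_zero] at h'
  rw [h']
  simp [rightNormed, Finsupp.linearCombination_single]

theorem wordRep_apply_nil (u : FreeLieAlgebra ℝ X) (v : List X →₀ ℝ) :
    wordRep X u v [] = 0 := by
  let K : LieSubalgebra ℝ (FreeLieAlgebra ℝ X) :=
    { carrier := {u | ∀ v, wordRep X u v [] = 0}
      zero_mem' := fun v => by simp
      add_mem' := fun {u₁ u₂} h₁ h₂ v => by simp [h₁ v, h₂ v]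
      smul_mem' := fun c u h v => by simp [h v]
      lie_mem' := fun {u₁ u₂} h₁ h₂ v => by
        simp [LieRing.of_associative_ring_bracket, h₁ _, h₂ _] }
  have h := eq_top_of_forall_of_mem K fun x v => by
    rw [wordRep, lift_of_apply]
    exact Finsupp.mapDomain_of_notMem_range _ _ (by simp)
  exact (h ▸ LieSubalgebra.mem_top u : u ∈ K) v

end Words

section Verma

variable (Λ : I → I → ℝ)

/-- The eigenvalue of `h i j` on the word `w` in the module of highest weight `Λ`. -/
noncomputable def wordWeight (i j : I) (w : List I) : ℝ :=
  Λ i j - if i = j then (w.map (A i)).sum else 0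

theorem wordWeight_cons (i j k : I) (w : List I) :
    wordWeight I A Λ i j (k :: w) = wordWeight I A Λ i j w - if i = j then A i k else 0 := by
  unfold wordWeight
  split_ifs <;> simp
  ring

/-- The action of `h i j` on words. -/
noncomputable def weightOp (i j : I) : Module.End ℝ (List I →₀ ℝ) :=
  Finsupp.linearCombination ℝ fun w => .single w (wordWeight I A Λ i j w)

theorem weightOp_single (i j : I) (w : List I) (c : ℝ) :
    weightOp I A Λ i j (.single w c) = wordWeight I A Λ i j w • .single w c := by
  simp [weightOp, Finsupp.linearCombination_single, mul_comm]

/-- The action of `e i` on a single word. -/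
noncomputable def contractWord (i : I) : List I → List I →₀ ℝ
  | [] => 0
  | j :: w => .single w (wordWeight I A Λ i j w) + consOp j (contractWord i w)

/-- The action of `e i` on words. -/
noncomputable def contractOp (i : I) : Module.End ℝ (List I →₀ ℝ) :=
  Finsupp.linearCombination ℝ (contractWord I A Λ i)

theorem contractOp_single (i : I) (w : List I) (c : ℝ) :
    contractOp I A Λ i (.single w c) = c • contractWord I A Λ i w :=
  Finsupp.linearCombination_single ..

theorem weightOp_consOp (i j k : I) (v : List I →₀ ℝ) :
    weightOp I A Λ i j (consOp k v) =
      consOp k (weightOp I A Λ i j v) - (if i = j then A i k else 0) • consOp k v := by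
  induction v using Finsupp.induction_linear with
  | zero => simp
  | add v w hv hw => simp only [map_add, hv, hw, smul_add]; abel
  | single w c =>
    rw [consOp_single, weightOp_single, weightOp_single, map_smul, consOp_single,
      wordWeight_cons, sub_smul]

theorem weightOp_contractWord (hΛ : ∀ p ∉ colEq I A, Λ p.1 p.2 = 0) (i j k : I) (w : List I) :
    weightOp I A Λ i j (contractWord I A Λ k w) =
      (wordWeight I A Λ i j w + if i = j then A i k else 0) • contractWord I A Λ k w := by
  induction w with
  | nil => simp [contractWord]
  | cons l w ih =>
    have key : ((if i = j then A i k else 0) - (if i = j then A i l else 0)) *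
        wordWeight I A Λ k l w = 0 := by
      by_cases hkl : (k, l) ∈ colEq I A
      · rw [hkl i, sub_self, zero_mul]
      · have hne : k ≠ l := by
          rintro rfl
          exact hkl fun _ => rfl
        rw [wordWeight, if_neg hne, hΛ _ hkl, sub_zero, mul_zero]
    rw [contractWord, map_add, weightOp_single, weightOp_consOp, ih, wordWeight_cons, map_smul,
      ← sub_smul, smul_add, Finsupp.smul_single, Finsupp.smul_single, smul_eq_mul, smul_eq_mul]
    congr 2
    · linear_combination -key
    · ring

/-- The representation of `ĝ₀(A)` of highest weight `Λ` on the span of the words in `I`. -/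
theorem hatGZero_exists_verma (hΛ : ∀ p ∉ colEq I A, Λ p.1 p.2 = 0) :
    ∃ φ : hatGZero I A →ₗ⁅ℝ⁆ Module.End ℝ (List I →₀ ℝ),
      (∀ i j, φ (hatH I A i j) (.single [] 1) = Λ i j • .single [] 1) ∧
      (∀ i, φ (hatE I A i) (.single [] 1) = 0) ∧ ∀ i, φ (hatF I A i) = consOp i := by
  have hext : ∀ {f g : Module.End ℝ (List I →₀ ℝ)},
      (∀ w, f (.single w 1) = g (.single w 1)) → f = g := fun h => by
    ext1 w
    ext1
    exact h w
  obtain ⟨φ, hH, hE, hF⟩ := hatGZero_exists_lift I A (weightOp I A Λ) (contractOp I A Λ) consOp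
    (fun i j k l => hext fun w => by
      simp only [LieRing.of_associative_ring_bracket, LinearMap.sub_apply, Module.End.mul_apply,
        weightOp_single, map_smul, LinearMap.zero_apply]
      rw [smul_comm, sub_self])
    (fun i j k => hext fun w => by
      simp only [LieRing.of_associative_ring_bracket, LinearMap.sub_apply, Module.End.mul_apply,
        weightOp_single, map_smul, contractOp_single, one_smul, LinearMap.smul_apply]
      rw [weightOp_contractWord I A Λ hΛ, add_smul, add_sub_cancel_left])
    (fun i j k => hext fun w => by
      simp only [LieRing.of_associative_ring_bracket, LinearMap.sub_apply, Module.End.mul_apply,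
        LinearMap.smul_apply, LinearMap.neg_apply]
      rw [weightOp_consOp]
      abel)
    (fun i j => hext fun w => by
      simp only [LieRing.of_associative_ring_bracket, LinearMap.sub_apply, Module.End.mul_apply]
      rw [consOp_single, contractOp_single, contractOp_single, weightOp_single, one_smul, one_smul,
        contractWord, add_sub_cancel_right]
      simp)
  refine ⟨φ, fun i j => ?_, fun i => ?_, hF⟩
  · rw [hH, weightOp_single]
    simp [wordWeight]
  · rw [hE, contractOp_single, contractWord, smul_zero]

end Verma

theorem hatGZero_exists_involution : ∃ σ : hatGZero I A →ₗ⁅ℝ⁆ hatGZero I A,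
    (∀ i j, σ (hatH I A i j) = -hatH I A j i) ∧
    (∀ i, σ (hatE I A i) = hatF I A i) ∧ ∀ i, σ (hatF I A i) = hatE I A i := by
  refine hatGZero_exists_lift I A (fun i j => -hatH I A j i) (hatF I A) (hatE I A)
    (fun i j k l => ?_) (fun i j k => ?_) (fun i j k => ?_) (fun i j => ?_)
  · rw [neg_lie, lie_neg, hatH_lie_hatH, neg_zero, neg_zero]
  · rw [neg_lie, hatH_lie_hatF, neg_neg]
    by_cases h : i = j
    · rw [h]
    · rw [if_neg h, if_neg (Ne.symm h)]
  · rw [neg_lie, hatH_lie_hatE]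
    by_cases h : i = j
    · rw [h]
    · rw [if_neg h, if_neg (Ne.symm h)]
  · rw [← lie_skew, hatE_lie_hatF]

theorem LieSubalgebra.lie_mem_lieSpan_of_forall_lie_mem {R L : Type*} [CommRing R] [LieRing L]
    [LieAlgebra R L] {s : Set L} {x : L} (h : ∀ y ∈ s, ⁅x, y⁆ ∈ lieSpan R L s) {y : L}
    (hy : y ∈ lieSpan R L s) : ⁅x, y⁆ ∈ lieSpan R L s := by
  induction hy using lieSpan_induction with
  | mem y hy => exact h y hy
  | zero => rw [lie_zero]; exact zero_mem _
  | add y z _ _ hy hz => rw [lie_add]; exact add_mem hy hz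
  | smul c y _ hy => rw [lie_smul]; exact SMulMemClass.smul_mem c hy
  | lie y z hy' hz' hy hz =>
    rw [leibniz_lie]
    exact add_mem (LieSubalgebra.lie_mem _ hy hz') (LieSubalgebra.lie_mem _ hy' hz)

theorem hatH_mem_hatHPart (i j : I) : hatH I A i j ∈ hatHPart I A :=
  Submodule.subset_span ⟨i, j, rfl⟩

theorem hatE_mem_hatNPlus (i : I) : hatE I A i ∈ hatNPlus I A :=
  LieSubalgebra.subset_lieSpan ⟨i, rfl⟩

theorem hatF_mem_hatNMinus (i : I) : hatF I A i ∈ hatNMinus I A :=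
  LieSubalgebra.subset_lieSpan ⟨i, rfl⟩

theorem hatHPart_lie_hatHPart {x y : hatGZero I A} (hx : x ∈ hatHPart I A)
    (hy : y ∈ hatHPart I A) : ⁅x, y⁆ = 0 := by
  induction hx using Submodule.span_induction with
  | zero => rw [zero_lie]
  | add x x' _ _ hx hx' => rw [add_lie, hx, hx', add_zero]
  | smul c x _ hx => rw [smul_lie, hx, smul_zero]
  | mem x hx =>
    obtain ⟨i, j, rfl⟩ := hx
    induction hy using Submodule.span_induction with
    | zero => rw [lie_zero]
    | add y y' _ _ hy hy' => rw [lie_add, hy, hy', add_zero]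
    | smul c y _ hy => rw [lie_smul, hy, smul_zero]
    | mem y hy =>
      obtain ⟨k, l, rfl⟩ := hy
      exact hatH_lie_hatH ..

theorem span_range_hatH_colEq :
    Submodule.span ℝ (Set.range fun p : colEq I A => hatH I A p.1.1 p.1.2) = hatHPart I A := by
  refine le_antisymm (Submodule.span_mono ?_) (Submodule.span_le.2 ?_)
  · rintro _ ⟨p, rfl⟩
    exact ⟨_, _, rfl⟩
  · rintro _ ⟨i, j, rfl⟩
    by_cases h : (i, j) ∈ colEq I A
    · exact Submodule.subset_span ⟨⟨_, h⟩, rfl⟩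
    · rw [hatH_eq_zero I A i j h]
      exact zero_mem _

theorem hatHPart_lie_hatNMinus {x y : hatGZero I A} (hx : x ∈ hatHPart I A)
    (hy : y ∈ hatNMinus I A) : ⁅x, y⁆ ∈ hatNMinus I A := by
  refine LieSubalgebra.lie_mem_lieSpan_of_forall_lie_mem ?_ hy
  rintro _ ⟨k, rfl⟩
  induction hx using Submodule.span_induction with
  | zero => rw [zero_lie]; exact zero_mem _
  | add x x' _ _ hx hx' => rw [add_lie]; exact add_mem hx hx'
  | smul c x _ hx => rw [smul_lie]; exact SMulMemClass.smul_mem c hx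
  | mem x hx =>
    obtain ⟨i, j, rfl⟩ := hx
    rw [hatH_lie_hatF]
    exact neg_mem (SMulMemClass.smul_mem _ (hatF_mem_hatNMinus I A k))

theorem hatE_lie_hatHPart (i : I) {x : hatGZero I A} (hx : x ∈ hatHPart I A) :
    ⁅hatE I A i, x⁆ ∈ hatNPlus I A := by
  induction hx using Submodule.span_induction with
  | zero => rw [lie_zero]; exact zero_mem _
  | add x x' _ _ hx hx' => rw [lie_add]; exact add_mem hx hx'
  | smul c x _ hx => rw [lie_smul]; exact SMulMemClass.smul_mem c hx
  | mem x hx =>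
    obtain ⟨j, k, rfl⟩ := hx
    rw [← lie_skew, hatH_lie_hatE]
    exact neg_mem (SMulMemClass.smul_mem _ (hatE_mem_hatNPlus I A i))

theorem hatE_lie_hatNMinus (i : I) {x : hatGZero I A} (hx : x ∈ hatNMinus I A) :
    ⁅hatE I A i, x⁆ ∈ (hatNMinus I A).toSubmodule ⊔ hatHPart I A := by
  have key : ∀ {y z}, y ∈ (hatNMinus I A).toSubmodule ⊔ hatHPart I A → z ∈ hatNMinus I A →
      ⁅y, z⁆ ∈ hatNMinus I A := by
    intro y z hy hz
    obtain ⟨a, ha, b, hb, rfl⟩ := Submodule.mem_sup.1 hy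
    rw [add_lie]
    exact add_mem (LieSubalgebra.lie_mem _ ha hz) (hatHPart_lie_hatNMinus I A hb hz)
  induction hx using LieSubalgebra.lieSpan_induction with
  | zero => rw [lie_zero]; exact zero_mem _
  | add x y _ _ hx hy => rw [lie_add]; exact add_mem hx hy
  | smul c x _ hx => rw [lie_smul]; exact Submodule.smul_mem _ c hx
  | mem x hx =>
    obtain ⟨j, rfl⟩ := hx
    rw [hatE_lie_hatF]
    exact Submodule.mem_sup_right (hatH_mem_hatHPart I A i j)
  | lie x y hx' hy' hx hy =>
    refine Submodule.mem_sup_left ?_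
    rw [leibniz_lie, ← lie_skew x]
    exact add_mem (s := hatNMinus I A) (key hx hy') (neg_mem (key hy hx'))

theorem hatGZero_sup_eq_top :
    (hatNMinus I A).toSubmodule ⊔ hatHPart I A ⊔ (hatNPlus I A).toSubmodule = ⊤ := by
  set W := (hatNMinus I A).toSubmodule ⊔ hatHPart I A ⊔ (hatNPlus I A).toSubmodule
  have hE : ∀ i, ∀ w ∈ W, ⁅hatE I A i, w⁆ ∈ W := by
    intro i w hw
    obtain ⟨d, hd, c, hc, rfl⟩ := Submodule.mem_sup.1 hw
    obtain ⟨a, ha, b, hb, rfl⟩ := Submodule.mem_sup.1 hd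
    rw [lie_add, lie_add]
    exact add_mem (add_mem (Submodule.mem_sup_left (hatE_lie_hatNMinus I A i ha))
      (Submodule.mem_sup_right (hatE_lie_hatHPart I A i hb)))
      (Submodule.mem_sup_right ((hatNPlus I A).lie_mem (hatE_mem_hatNPlus I A i) hc))
  obtain ⟨σ, hσH, hσE, hσF⟩ := hatGZero_exists_involution I A
  have hσ : ∀ x, σ (σ x) = x := by
    let K : LieSubalgebra ℝ (hatGZero I A) :=
      { carrier := {x | σ (σ x) = x}
        zero_mem' := by simp
        add_mem' := fun {x y} (hx : σ (σ x) = x) (hy : σ (σ y) = y) => by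
          rw [Set.mem_ofPred_eq, map_add, map_add, hx, hy]
        smul_mem' := fun c x (hx : σ (σ x) = x) => by
          rw [Set.mem_ofPred_eq, map_smul, map_smul, hx]
        lie_mem' := fun {x y} (hx : σ (σ x) = x) (hy : σ (σ y) = y) => by
          change σ (σ ⁅x, y⁆) = ⁅x, y⁆
          rw [LieHom.map_lie, LieHom.map_lie, hx, hy] }
    have hK := hatGZero_eq_top I A K (fun i => by change σ (σ _) = _; rw [hσE, hσF])
      fun i => by change σ (σ _) = _; rw [hσF, hσE]
    exact fun x => (hK ▸ LieSubalgebra.mem_top x : x ∈ K)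
  have hσW : W ≤ W.comap σ.toLinearMap := by
    refine sup_le (sup_le ?_ (Submodule.span_le.2 ?_)) ?_
    · have : hatNMinus I A ≤ (hatNPlus I A).comap σ := by
        refine LieSubalgebra.lieSpan_le.2 ?_
        rintro _ ⟨i, rfl⟩
        change σ (hatF I A i) ∈ hatNPlus I A
        rw [hσF]
        exact hatE_mem_hatNPlus I A i
      exact fun x hx => Submodule.mem_sup_right (this hx)
    · rintro _ ⟨i, j, rfl⟩
      change σ _ ∈ W
      rw [hσH]
      exact neg_mem (Submodule.mem_sup_left (Submodule.mem_sup_right (hatH_mem_hatHPart I A j i)))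
    · have : hatNPlus I A ≤ (hatNMinus I A).comap σ := by
        refine LieSubalgebra.lieSpan_le.2 ?_
        rintro _ ⟨i, rfl⟩
        change σ (hatE I A i) ∈ hatNMinus I A
        rw [hσE]
        exact hatF_mem_hatNMinus I A i
      exact fun x hx => Submodule.mem_sup_left (Submodule.mem_sup_left (this hx))
  have hF : ∀ i, ∀ w ∈ W, ⁅hatF I A i, w⁆ ∈ W := by
    intro i w hw
    rw [← hσ w, ← hσE, ← LieHom.map_lie]
    exact hσW (hE i _ (hσW hw))
  let K : LieSubalgebra ℝ (hatGZero I A) :=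
    { carrier := {x | ∀ w ∈ W, ⁅x, w⁆ ∈ W}
      zero_mem' := fun w _ => by rw [zero_lie]; exact zero_mem _
      add_mem' := fun hx hy w hw => by rw [add_lie]; exact add_mem (hx w hw) (hy w hw)
      smul_mem' := fun c x hx w hw => by rw [smul_lie]; exact W.smul_mem c (hx w hw)
      lie_mem' := fun hx hy w hw => by
        rw [lie_lie]
        exact sub_mem (hx _ (hy w hw)) (hy _ (hx w hw)) }
  have hK := hatGZero_eq_top I A K hE hF
  have hW' := hatGZero_eq_top I A
    { W with lie_mem' := fun {x y} _ hy => (hK ▸ LieSubalgebra.mem_top x : x ∈ K) y hy }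
    (fun i => Submodule.mem_sup_right (hatE_mem_hatNPlus I A i))
    (fun i => Submodule.mem_sup_left (Submodule.mem_sup_left (hatF_mem_hatNMinus I A i)))
  exact congrArg LieSubalgebra.toSubmodule hW'

theorem hatECanon_range : (hatECanon I A).range = hatNPlus I A :=
  FreeLieAlgebra.range_lift _

theorem hatFCanon_range : (hatFCanon I A).range = hatNMinus I A :=
  FreeLieAlgebra.range_lift _

section Independence

variable {Λ : I → I → ℝ} {φ : hatGZero I A →ₗ⁅ℝ⁆ Module.End ℝ (List I →₀ ℝ)}

theorem wordRep_eq_of_hatF (hF : ∀ i, φ (hatF I A i) = consOp i) (u : FreeLieAlgebra ℝ I) :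
    φ (hatFCanon I A u) = wordRep I u := by
  have h : φ.comp (hatFCanon I A) = wordRep I := by
    ext1 i
    rw [LieHom.comp_apply, hatFCanon, wordRep, lift_of_apply, lift_of_apply, hF]
  exact LieHom.congr_fun h u

theorem eq_zero_of_mem_hatNMinus (hF : ∀ i, φ (hatF I A i) = consOp i) {x : hatGZero I A}
    (hx : x ∈ hatNMinus I A) (h0 : φ x (.single [] 1) = 0) : x = 0 := by
  rw [← hatFCanon_range] at hx
  obtain ⟨u, rfl⟩ := hx
  change φ (hatFCanon I A u) (.single [] 1) = 0 at h0
  rw [wordRep_eq_of_hatF I A hF] at h0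
  change hatFCanon I A u = 0
  rw [eq_zero_of_wordRep_apply_eq_zero h0, map_zero]

theorem apply_nil_of_mem_hatNMinus (hF : ∀ i, φ (hatF I A i) = consOp i) {x : hatGZero I A}
    (hx : x ∈ hatNMinus I A) : φ x (.single [] 1) [] = 0 := by
  rw [← hatFCanon_range] at hx
  obtain ⟨u, rfl⟩ := hx
  change φ (hatFCanon I A u) (.single [] 1) [] = 0
  rw [wordRep_eq_of_hatF I A hF]
  exact wordRep_apply_nil u _

theorem apply_single_nil_of_mem_hatNPlus (hE : ∀ i, φ (hatE I A i) (.single [] 1) = 0)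
    {x : hatGZero I A} (hx : x ∈ hatNPlus I A) : φ x (.single [] 1) = 0 := by
  induction hx using LieSubalgebra.lieSpan_induction with
  | zero => simp
  | add x y _ _ hx hy => simp [hx, hy]
  | smul c x _ hx => simp [hx]
  | mem x hx =>
    obtain ⟨i, rfl⟩ := hx
    exact hE i
  | lie x y _ _ hx hy => simp [LieRing.of_associative_ring_bracket, hx, hy]

end Independence

theorem hatFCanon_injective : Function.Injective (hatFCanon I A) := by
  obtain ⟨φ, -, -, hF⟩ := hatGZero_exists_verma I A 0 fun _ _ => rfl
  rw [injective_iff_map_eq_zero]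
  intro u hu
  refine eq_zero_of_wordRep_apply_eq_zero ?_
  rw [← wordRep_eq_of_hatF I A hF, hu, map_zero, LinearMap.zero_apply]

theorem hatECanon_injective : Function.Injective (hatECanon I A) := by
  obtain ⟨σ, -, hσE, -⟩ := hatGZero_exists_involution I A
  have h : σ.comp (hatECanon I A) = hatFCanon I A := by
    ext1 i
    rw [LieHom.comp_apply, hatECanon, hatFCanon, lift_of_apply, lift_of_apply, hσE]
  have h' : Function.Injective (σ ∘ hatECanon I A) := by
    rw [← LieHom.coe_comp, h]
    exact hatFCanon_injective I A
  exact h'.of_comp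

/-- The coordinate functional dual to `h i j`, for `(i, j) = q`. -/
theorem hatGZero_exists_coord (q : colEq I A) : ∃ ξ : hatGZero I A →ₗ[ℝ] ℝ,
    (∀ p : colEq I A, ξ (hatH I A p.1.1 p.1.2) = if p = q then 1 else 0) ∧
    (∀ x ∈ hatNMinus I A, ξ x = 0) ∧ ∀ x ∈ hatNPlus I A, ξ x = 0 := by
  obtain ⟨φ, hH, hE, hF⟩ := hatGZero_exists_verma I A
    (fun i j => if (i, j) = q.1 then 1 else 0) fun p hp => if_neg fun (h : p = q.1) => hp (h ▸ q.2)
  refine ⟨Finsupp.lapply [] ∘ₗ LinearMap.applyₗ (Finsupp.single ([] : List I) (1 : ℝ)) ∘ₗ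
    φ.toLinearMap, fun p => ?_,
    fun x hx => apply_nil_of_mem_hatNMinus I A hF hx, fun x hx => ?_⟩
  · change φ (hatH I A p.1.1 p.1.2) (.single [] 1) [] = _
    rw [hH]
    rw [Finsupp.smul_apply, Finsupp.single_eq_same]
    simp [Subtype.ext_iff]
  · change φ x (.single [] 1) [] = _
    rw [apply_single_nil_of_mem_hatNPlus I A hE hx, Finsupp.zero_apply]

theorem coord_linearCombination_hatH {q : colEq I A} {ξ : hatGZero I A →ₗ[ℝ] ℝ}
    (hξ : ∀ p : colEq I A, ξ (hatH I A p.1.1 p.1.2) = if p = q then 1 else 0)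
    (c : colEq I A →₀ ℝ) :
    ξ (Finsupp.linearCombination ℝ (fun p : colEq I A => hatH I A p.1.1 p.1.2) c) = c q := by
  rw [Finsupp.apply_linearCombination]
  have : (ξ ∘ fun p : colEq I A => hatH I A p.1.1 p.1.2) = fun p => if p = q then 1 else 0 :=
    funext hξ
  rw [this, Finsupp.linearCombination_apply]
  simp [Finsupp.sum, eq_comm]

theorem linearIndependent_hatH :
    LinearIndependent ℝ (fun p : colEq I A => hatH I A p.1.1 p.1.2) := by
  refine linearIndependent_iff.2 fun c hc => Finsupp.ext fun q => ?_
  obtain ⟨ξ, hξ, -, -⟩ := hatGZero_exists_coord I A q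
  rw [← coord_linearCombination_hatH I A hξ, hc, map_zero, Finsupp.zero_apply]

theorem hatGZero_eq_zero_of_add_eq_zero {a b c : hatGZero I A} (ha : a ∈ hatNMinus I A)
    (hb : b ∈ hatHPart I A) (hc : c ∈ hatNPlus I A) (h : a + b + c = 0) :
    a = 0 ∧ b = 0 ∧ c = 0 := by
  have hb0 : b = 0 := by
    rw [← span_range_hatH_colEq, Finsupp.mem_span_range_iff_exists_finsupp] at hb
    obtain ⟨k, rfl⟩ := hb
    change Finsupp.linearCombination ℝ (fun p : colEq I A => hatH I A p.1.1 p.1.2) k = 0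
    suffices k = 0 by rw [this, map_zero]
    refine Finsupp.ext fun q => ?_
    obtain ⟨ξ, hξ, hN, hP⟩ := hatGZero_exists_coord I A q
    have h' := congrArg ξ h
    rw [map_add, map_add, hN a ha, hP c hc, zero_add, add_zero, map_zero] at h'
    rw [← coord_linearCombination_hatH I A hξ]
    exact h'
  obtain ⟨φ, -, hE, hF⟩ := hatGZero_exists_verma I A 0 fun _ _ => rfl
  rw [hb0, add_zero] at h
  have ha0 : a = 0 := by
    refine eq_zero_of_mem_hatNMinus I A hF ha ?_
    rw [eq_neg_of_add_eq_zero_left h, map_neg, LinearMap.neg_apply,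
      apply_single_nil_of_mem_hatNPlus I A hE hc, neg_zero]
  exact ⟨ha0, hb0, by rwa [ha0, zero_add] at h⟩

theorem linearIndependent_hatF : LinearIndependent ℝ (hatF I A) := by
  obtain ⟨φ, -, -, hF⟩ := hatGZero_exists_verma I A 0 fun _ _ => rfl
  refine LinearIndependent.of_comp
    (LinearMap.applyₗ (Finsupp.single ([] : List I) (1 : ℝ)) ∘ₗ φ.toLinearMap) ?_
  have h : (LinearMap.applyₗ (Finsupp.single ([] : List I) (1 : ℝ)) ∘ₗ φ.toLinearMap) ∘ hatF I A =
      (fun w : List I => Finsupp.single w (1 : ℝ)) ∘ fun i => [i] := by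
    funext i
    change φ (hatF I A i) (.single [] 1) = _
    rw [hF, consOp_single]
    rfl
  rw [h]
  exact (Finsupp.linearIndependent_single_one ℝ (List I)).comp _ fun i j h => by simpa using h

theorem linearIndependent_hatE : LinearIndependent ℝ (hatE I A) := by
  obtain ⟨σ, -, hσE, -⟩ := hatGZero_exists_involution I A
  refine LinearIndependent.of_comp σ.toLinearMap ?_
  rw [show σ.toLinearMap ∘ hatE I A = hatF I A from funext hσE]
  exact linearIndependent_hatF I A

theorem linearIndependent_combinedFamily : LinearIndependent ℝ (combinedFamily I A) := by
  have hfam : combinedFamily I A = Sum.elim (hatE I A)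
      (Sum.elim (hatF I A) fun p : colEq I A => hatH I A p.1.1 p.1.2) := by
    funext x
    rcases x with i | i | p <;> rfl
  have hE : Submodule.span ℝ (Set.range (hatE I A)) ≤ (hatNPlus I A).toSubmodule :=
    LieSubalgebra.submodule_span_le_lieSpan
  have hF : Submodule.span ℝ (Set.range (hatF I A)) ≤ (hatNMinus I A).toSubmodule :=
    LieSubalgebra.submodule_span_le_lieSpan
  rw [hfam]
  refine (linearIndependent_hatE I A).sum_type ((linearIndependent_hatF I A).sum_type
    (linearIndependent_hatH I A) ?_) ?_
  · rw [span_range_hatH_colEq]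
    refine Submodule.disjoint_def.2 fun x hx hx' => ?_
    exact (hatGZero_eq_zero_of_add_eq_zero I A (hF hx) (neg_mem hx') (zero_mem _)
      (by simp)).1
  · rw [Set.Sum.elim_range, Submodule.span_union, span_range_hatH_colEq]
    refine Submodule.disjoint_def.2 fun x hx hx' => ?_
    obtain ⟨a, ha, b, hb, rfl⟩ := Submodule.mem_sup.1 hx'
    exact neg_eq_zero.1 (hatGZero_eq_zero_of_add_eq_zero I A (hF ha) hb
      (neg_mem (s := hatNPlus I A) (hE hx)) (by simp)).2.2

theorem DirectSum.isInternal_fin_three {R M : Type*} [Ring R] [AddCommGroup M] [Module R M]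
    {N H P : Submodule R M}
    (h : ∀ a ∈ N, ∀ b ∈ H, ∀ c ∈ P, a + b + c = 0 → a = 0 ∧ b = 0 ∧ c = 0)
    (htop : N ⊔ H ⊔ P = ⊤) : DirectSum.IsInternal ![N, H, P] := by
  rw [DirectSum.isInternal_submodule_iff_iSupIndep_and_iSup_eq_top]
  constructor
  · have h0 : Disjoint N (H ⊔ P) := by
      refine Submodule.disjoint_def.2 fun x hx hx' => ?_
      obtain ⟨b, hb, c, hc, rfl⟩ := Submodule.mem_sup.1 hx'
      exact neg_eq_zero.1 (h _ (neg_mem hx) b hb c hc (by abel)).1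
    have h1 : Disjoint H (N ⊔ P) := by
      refine Submodule.disjoint_def.2 fun x hx hx' => ?_
      obtain ⟨a, ha, c, hc, rfl⟩ := Submodule.mem_sup.1 hx'
      exact neg_eq_zero.1 (h a ha _ (neg_mem hx) c hc (by abel)).2.1
    have h2 : Disjoint P (N ⊔ H) := by
      refine Submodule.disjoint_def.2 fun x hx hx' => ?_
      obtain ⟨a, ha, b, hb, rfl⟩ := Submodule.mem_sup.1 hx'
      exact neg_eq_zero.1 (h a ha b hb _ (neg_mem hx) (by abel)).2.2
    intro i
    fin_cases i
    · refine h0.mono_right (iSup₂_le fun j hj => ?_)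
      fin_cases j
      exacts [absurd rfl hj, le_sup_left, le_sup_right]
    · refine h1.mono_right (iSup₂_le fun j hj => ?_)
      fin_cases j
      exacts [le_sup_left, absurd rfl hj, le_sup_right]
    · refine h2.mono_right (iSup₂_le fun j hj => ?_)
      fin_cases j
      exacts [le_sup_left, le_sup_right, absurd rfl hj]
  · refine eq_top_iff.2 (htop ▸ sup_le (sup_le ?_ ?_) ?_)
    exacts [le_iSup ![N, H, P] 0, le_iSup ![N, H, P] 1, le_iSup ![N, H, P] 2]

theorem hatGZero_triangular_decomposition (I : Type) [Countable I] (A : I → I → ℝ) :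
    -- triangular decomposition as a direct sum of vector spaces
    DirectSum.IsInternal
      ![(hatNMinus I A).toSubmodule, hatHPart I A, (hatNPlus I A).toSubmodule] ∧
    -- `ĥ` is abelian
    (∀ x ∈ hatHPart I A, ∀ y ∈ hatHPart I A, ⁅x, y⁆ = 0) ∧
    -- the `h i j` with equal `i`-th and `j`-th columns form a basis of `ĥ`
    LinearIndependent ℝ (fun p : colEq I A => hatH I A p.1.1 p.1.2) ∧
    Submodule.span ℝ (Set.range (fun p : colEq I A => hatH I A p.1.1 p.1.2))
      = hatHPart I A ∧
    -- `n̂₀⁺` is the free Lie algebra on the `eᵢ`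
    Function.Injective (hatECanon I A) ∧ (hatECanon I A).range = hatNPlus I A ∧
    -- `n̂₀⁻` is the free Lie algebra on the `fᵢ`
    Function.Injective (hatFCanon I A) ∧ (hatFCanon I A).range = hatNMinus I A ∧
    -- linear independence of `{eᵢ, fᵢ} ∪ {h i j : (i,j) ∈ S}`
    LinearIndependent ℝ (combinedFamily I A) := by
  exact ⟨DirectSum.isInternal_fin_three
      (fun _ ha _ hb _ hc h => hatGZero_eq_zero_of_add_eq_zero I A ha hb hc h)
      (hatGZero_sup_eq_top I A),
    fun _ hx _ hy => hatHPart_lie_hatHPart I A hx hy, linearIndependent_hatH I A,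
    span_range_hatH_colEq I A, hatECanon_injective I A, hatECanon_range I A,
    hatFCanon_injective I A, hatFCanon_range I A, linearIndependent_combinedFamily I A⟩
end

section
/- Let I be an at most countable index set and A = (a_{ij})_{i,j∈I} a real matrix satisfying conditions C1–C3. Let k̂_0^+ be the ideal of the subalgebra n̂_0^+ of ĝ_0(A) generated by the elements d^+_{ij} (i ≠ j, a_{ii} > 0) and the elements [e_i,e_j] with i ≠ j and a_{ij} = 0, and let k̂_0^- be the ideal of n̂_0^- generated by the elements d^-_{ij} (i ≠ j, a_{ii} > 0) and [f_i,f_j] with i ≠ j and a_{ij} = 0. Then k̂_0^+ and k̂_0^- and k̂_0 = k̂_0^+ ⊕ k̂_0^- are ideals of the whole Lie algebra ĝ_0(A). -/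
/-!
Statement 5: the ideals `k̂₀⁺` of `n̂₀⁺` and `k̂₀⁻` of `n̂₀⁻` generated by the Serre-type
elements, and their (direct) sum `k̂₀`, are ideals of all of `ĝ₀(A)`.
-/

open FreeLieAlgebra
open scoped Classical

variable (I : Type) (A : I → I → ℝ)

/-- The generators of `k̂₀⁺`: the `d⁺ᵢⱼ` and the `⁅eᵢ,eⱼ⁆` with `i ≠ j`, `aᵢⱼ = 0`. -/
noncomputable def kPlusGens : Set (hatGZero I A) :=
  {x | ∃ i j : I, ∃ n : ℕ, i ≠ j ∧ 0 < A i i ∧ (n : ℝ) = 1 - 2 * A i j / A i i ∧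
    x = ((LieAlgebra.ad ℝ (hatGZero I A) (hatE I A i)) ^ n) (hatE I A j)} ∪
  {x | ∃ i j : I, i ≠ j ∧ A i j = 0 ∧ x = ⁅hatE I A i, hatE I A j⁆}

/-- The generators of `k̂₀⁻`: the `d⁻ᵢⱼ` and the `⁅fᵢ,fⱼ⁆` with `i ≠ j`, `aᵢⱼ = 0`. -/
noncomputable def kMinusGens : Set (hatGZero I A) :=
  {x | ∃ i j : I, ∃ n : ℕ, i ≠ j ∧ 0 < A i i ∧ (n : ℝ) = 1 - 2 * A i j / A i i ∧
    x = ((LieAlgebra.ad ℝ (hatGZero I A) (hatF I A i)) ^ n) (hatF I A j)} ∪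
  {x | ∃ i j : I, i ≠ j ∧ A i j = 0 ∧ x = ⁅hatF I A i, hatF I A j⁆}

/-- `k̂₀⁺`, the ideal of `n̂₀⁺` generated by `kPlusGens` (equivalently, the
`n̂₀⁺`-submodule of `ĝ₀(A)` generated by `kPlusGens`, which is contained in `n̂₀⁺`). -/
noncomputable def kHatPlus : LieSubmodule ℝ (hatNPlus I A) (hatGZero I A) :=
  LieSubmodule.lieSpan ℝ _ (kPlusGens I A)

/-- `k̂₀⁻`, the ideal of `n̂₀⁻` generated by `kMinusGens`. -/
noncomputable def kHatMinus : LieSubmodule ℝ (hatNMinus I A) (hatGZero I A) :=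
  LieSubmodule.lieSpan ℝ _ (kMinusGens I A)

section ChevalleyGenerators

variable {I : Type} {A : I → I → ℝ} {L : Type*} [LieRing L] [LieAlgebra ℝ L]

/-- A Lie algebra generated by elements `e i`, `f i` that satisfy the defining relations of
`ĝ₀(A)`, with `h i j = ⁅e i, f j⁆`. -/
structure IsHatSystem (A : I → I → ℝ) (e f : I → L) (h : I → I → L) : Prop where
  lie_h_h : ∀ i j k l, ⁅h i j, h k l⁆ = 0
  lie_h_e : ∀ i j k, ⁅h i j, e k⁆ = (if i = j then A i k else 0) • e k
  lie_h_f : ∀ i j k, ⁅h i j, f k⁆ = -((if i = j then A i k else 0) • f k)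
  lie_e_f : ∀ i j, ⁅e i, f j⁆ = h i j
  span_eq_top : LieSubalgebra.lieSpan ℝ L (Set.range e ∪ Set.range f) = ⊤

/-- The Serre-type elements attached to a family `e`. -/
def serreElements (A : I → I → ℝ) (e : I → L) : Set L :=
  {x | ∃ i j : I, ∃ n : ℕ, i ≠ j ∧ 0 < A i i ∧ (n : ℝ) = 1 - 2 * A i j / A i i ∧
    x = ((LieAlgebra.ad ℝ L (e i)) ^ n) (e j)} ∪
  {x | ∃ i j : I, i ≠ j ∧ A i j = 0 ∧ x = ⁅e i, e j⁆}

namespace IsHatSystem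

variable {e f : I → L} {h : I → I → L}

/-- Exchanging the roles of `e` and `f`. -/
lemma swap (H : IsHatSystem A e f h) : IsHatSystem A f e (fun i j => -h j i) where
  lie_h_h i j k l := by simp [H.lie_h_h]
  lie_h_e i j k := by
    rw [neg_lie, H.lie_h_f, neg_neg]
    by_cases hij : i = j
    · subst hij; rfl
    · simp [hij, Ne.symm hij]
  lie_h_f i j k := by
    rw [neg_lie, H.lie_h_e]
    by_cases hij : i = j
    · subst hij; rfl
    · simp [hij, Ne.symm hij]
  lie_e_f i j := by rw [← lie_skew, H.lie_e_f]
  span_eq_top := by rw [Set.union_comm, H.span_eq_top]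

lemma lie_f_e (H : IsHatSystem A e f h) (i j : I) : ⁅f i, e j⁆ = -h j i := by
  rw [← lie_skew, H.lie_e_f]

lemma h_eq_zero (H : IsHatSystem A e f h) {i j k : I} (hk : A k i ≠ A k j) : h i j = 0 := by
  have h1 : ⁅h k k, ⁅e i, f j⁆⁆ = 0 := by rw [H.lie_e_f, H.lie_h_h]
  rw [leibniz_lie, H.lie_h_e, H.lie_h_f, if_pos rfl, if_pos rfl, smul_lie, lie_neg, lie_smul,
    H.lie_e_f, ← sub_eq_add_neg, ← sub_smul] at h1
  exact (smul_eq_zero.mp h1).resolve_left (sub_ne_zero.mpr hk)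

lemma lie_h_ad_pow (H : IsHatSystem A e f h) (i j k l : I) (n : ℕ) :
    ⁅h k l, ((LieAlgebra.ad ℝ L (e i)) ^ n) (e j)⁆ =
      (if k = l then A k j + n * A k i else 0) • ((LieAlgebra.ad ℝ L (e i)) ^ n) (e j) := by
  induction n with
  | zero => simp [H.lie_h_e]
  | succ n ih =>
    rw [pow_succ', Module.End.mul_apply, LieAlgebra.ad_apply, leibniz_lie, ih, H.lie_h_e,
      smul_lie, lie_smul, ← add_smul]
    congr 1
    split_ifs
    · push_cast; ring
    · simp

lemma lie_f_ad_pow (H : IsHatSystem A e f h) {i j : I} (hji : h j i = 0) (n : ℕ) :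
    ⁅f i, ((LieAlgebra.ad ℝ L (e i)) ^ (n + 1)) (e j)⁆ =
      (-((n + 1) * (A i j + n * A i i / 2))) • ((LieAlgebra.ad ℝ L (e i)) ^ n) (e j) := by
  induction n with
  | zero =>
    rw [zero_add, pow_one, LieAlgebra.ad_apply, leibniz_lie, H.lie_f_e, H.lie_f_e, hji, neg_lie,
      H.lie_h_e]
    simp
  | succ n ih =>
    rw [pow_succ', Module.End.mul_apply, LieAlgebra.ad_apply, leibniz_lie, ih, H.lie_f_e,
      neg_lie, H.lie_h_ad_pow, lie_smul, ← LieAlgebra.ad_apply ℝ L (e i),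
      ← Module.End.mul_apply, ← pow_succ', ← neg_smul, ← add_smul, if_pos rfl]
    congr 1
    push_cast
    ring

lemma lie_f_ad_pow_of_ne (H : IsHatSystem A e f h) {i k : I} (hik : h i k = 0) (j : I) (n : ℕ) :
    ⁅f k, ((LieAlgebra.ad ℝ L (e i)) ^ n) (e j)⁆ =
      -((LieAlgebra.ad ℝ L (e i)) ^ n) (h j k) := by
  induction n with
  | zero => simp [H.lie_f_e]
  | succ n ih =>
    rw [pow_succ', Module.End.mul_apply, LieAlgebra.ad_apply, leibniz_lie, ih, H.lie_f_e, hik,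
      neg_zero, zero_lie, zero_add, lie_neg]
    rfl

lemma lie_e_h (H : IsHatSystem A e f h) (i j k : I) :
    ⁅e i, h j k⁆ = -((if j = k then A j i else 0) • e i) := by
  rw [← lie_skew, H.lie_h_e]

lemma lie_f_serreElements (H : IsHatSystem A e f h) (hC1 : ∀ i j, A i j = A j i)
    (hC2 : ∀ i j, i ≠ j → A i j ≤ 0) {s : L} (hs : s ∈ serreElements A e) (k : I) :
    ⁅f k, s⁆ = 0 := by
  rcases hs with ⟨i, j, n, hij, hii, hn, rfl⟩ | ⟨i, j, hij, h0, rfl⟩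
  · have hAij := hC2 i j hij
    have h2 : (n : ℝ) * A i i = A i i - 2 * A i j := by
      rw [hn]; field_simp
    obtain _ | n := n
    · push_cast at h2; linarith
    push_cast at h2
    by_cases hki : k = i
    · subst hki
      have hji : h j k = 0 := H.h_eq_zero (k := k) (by linarith)
      rw [H.lie_f_ad_pow hji]
      have : A k j + n * A k k / 2 = 0 := by linarith
      rw [this]; simp
    · have hAik := hC2 i k (Ne.symm hki)
      have hik : h i k = 0 := H.h_eq_zero (k := i) (by linarith)
      rw [H.lie_f_ad_pow_of_ne hik, pow_succ, Module.End.mul_apply, LieAlgebra.ad_apply, H.lie_e_h]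
      by_cases hjk : j = k
      · obtain _ | n := n
        · have : A j i = 0 := by rw [hC1]; push_cast at h2; linarith
          simp [this]
        · rw [pow_succ, Module.End.mul_apply, LieAlgebra.ad_apply, lie_neg, lie_smul, lie_self]
          simp
      · simp [hjk]
  · have hji : A j i = 0 := by rw [hC1, h0]
    rw [leibniz_lie, H.lie_f_e, H.lie_f_e, neg_lie, lie_neg, H.lie_h_e, H.lie_e_h]
    simp [h0, hji]

lemma lie_h_serreElements (H : IsHatSystem A e f h) {s : L} (hs : s ∈ serreElements A e)
    (k l : I) : ∃ c : ℝ, ⁅h k l, s⁆ = c • s := by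
  rcases hs with ⟨i, j, n, -, -, -, rfl⟩ | ⟨i, j, -, -, rfl⟩
  · exact ⟨_, H.lie_h_ad_pow i j k l n⟩
  · have := H.lie_h_ad_pow i j k l 1
    rw [pow_one, LieAlgebra.ad_apply] at this
    exact ⟨_, this⟩

/-- A submodule stable under bracketing with every element of `G` is stable under bracketing with
the subalgebra generated by `G`. -/
lemma lie_mem_of_generators {G : Set L} (p : Submodule ℝ L)
    (hG : ∀ x ∈ G, ∀ y ∈ p, ⁅x, y⁆ ∈ p) {x : L} (hx : x ∈ LieSubalgebra.lieSpan ℝ L G) :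
    ∀ y ∈ p, ⁅x, y⁆ ∈ p := by
  induction hx using LieSubalgebra.lieSpan_induction with
  | mem x hx => exact hG x hx
  | zero => intro y _; simp
  | add x z _ _ hx hz =>
    intro y hy; rw [add_lie]; exact p.add_mem (hx y hy) (hz y hy)
  | smul t x _ hx => intro y hy; rw [smul_lie]; exact p.smul_mem t (hx y hy)
  | lie x z _ _ hx hz =>
    intro y hy
    rw [lie_lie]
    exact p.sub_mem (hx _ (hz y hy)) (hz _ (hx y hy))

/-- The submodule generated by the Serre-type elements under the subalgebra generated by the `e i`
is an ideal of the whole Lie algebra. -/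
lemma lie_mem_lieSpan_serreElements (H : IsHatSystem A e f h) (hC1 : ∀ i j, A i j = A j i)
    (hC2 : ∀ i j, i ≠ j → A i j ≤ 0) (x : L) :
    ∀ y ∈ LieSubmodule.lieSpan ℝ (LieSubalgebra.lieSpan ℝ L (Set.range e)) (serreElements A e),
      ⁅x, y⁆ ∈
        LieSubmodule.lieSpan ℝ (LieSubalgebra.lieSpan ℝ L (Set.range e)) (serreElements A e) := by
  set K := LieSubmodule.lieSpan ℝ (LieSubalgebra.lieSpan ℝ L (Set.range e)) (serreElements A e)
  have he : ∀ i, ∀ y ∈ K, ⁅e i, y⁆ ∈ K := fun i y hy =>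
    K.lie_mem (x := ⟨e i, LieSubalgebra.subset_lieSpan ⟨i, rfl⟩⟩) hy
  let Q : Submodule ℝ L :=
    { carrier := {y | y ∈ K ∧ (∀ k, ⁅f k, y⁆ ∈ K) ∧ ∀ k l, ⁅h k l, y⁆ ∈ K}
      add_mem' := fun {y z} hy hz => ⟨add_mem hy.1 hz.1,
        fun k => by rw [lie_add]; exact add_mem (hy.2.1 k) (hz.2.1 k),
        fun k l => by rw [lie_add]; exact add_mem (hy.2.2 k l) (hz.2.2 k l)⟩
      zero_mem' := ⟨zero_mem _, fun k => by rw [lie_zero]; exact zero_mem _,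
        fun k l => by rw [lie_zero]; exact zero_mem _⟩
      smul_mem' := fun t y hy => ⟨K.smul_mem t hy.1,
        fun k => by rw [lie_smul]; exact K.smul_mem t (hy.2.1 k),
        fun k l => by rw [lie_smul]; exact K.smul_mem t (hy.2.2 k l)⟩ }
  have hQe : ∀ x ∈ Set.range e, ∀ y ∈ Q, ⁅x, y⁆ ∈ Q := by
    rintro _ ⟨i, rfl⟩ y ⟨hy, hyf, hyh⟩
    refine ⟨he i y hy, fun k => ?_, fun k l => ?_⟩
    · rw [leibniz_lie, H.lie_f_e, neg_lie]
      exact add_mem (neg_mem (hyh i k)) (he i _ (hyf k))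
    · rw [leibniz_lie, H.lie_h_e, smul_lie]
      exact add_mem (K.smul_mem _ (he i y hy)) (he i _ (hyh k l))
  have hKQ : ∀ y ∈ K, y ∈ Q := by
    intro y hy
    induction hy using LieSubmodule.lieSpan_induction with
    | mem s hs =>
      have hsK : s ∈ K := LieSubmodule.subset_lieSpan hs
      refine ⟨hsK, fun k => ?_, fun k l => ?_⟩
      · rw [H.lie_f_serreElements hC1 hC2 hs]; exact zero_mem _
      · obtain ⟨c, hc⟩ := H.lie_h_serreElements hs k l
        rw [hc]; exact K.smul_mem c hsK
    | zero => exact zero_mem _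
    | add y z _ _ hy hz => exact add_mem hy hz
    | smul t y _ hy => exact Q.smul_mem t hy
    | lie x y _ hy => exact lie_mem_of_generators Q hQe x.2 y hy
  refine lie_mem_of_generators (G := Set.range e ∪ Set.range f) K.toSubmodule ?_
    (by rw [H.span_eq_top]; trivial)
  rintro _ (⟨i, rfl⟩ | ⟨i, rfl⟩) y hy
  · exact he i y hy
  · exact (hKQ y hy).2.1 i

end IsHatSystem

/-- The Lie submodule generated by the Serre-type elements is contained in the subalgebra
generated by the `e i`. -/
lemma lieSpan_serreElements_le (A : I → I → ℝ) (e : I → L) :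
    (LieSubmodule.lieSpan ℝ (LieSubalgebra.lieSpan ℝ L (Set.range e))
      (serreElements A e)).toSubmodule ≤ (LieSubalgebra.lieSpan ℝ L (Set.range e)).toSubmodule := by
  set N := LieSubalgebra.lieSpan ℝ L (Set.range e)
  have he : ∀ i, e i ∈ N := fun i => LieSubalgebra.subset_lieSpan ⟨i, rfl⟩
  have hpow : ∀ i j n, ((LieAlgebra.ad ℝ L (e i)) ^ n) (e j) ∈ N := by
    intro i j n
    induction n with
    | zero => exact he j
    | succ n ih =>
      rw [pow_succ', Module.End.mul_apply, LieAlgebra.ad_apply]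
      exact N.lie_mem (he i) ih
  intro y hy
  rw [LieSubmodule.mem_toSubmodule] at hy
  rw [LieSubalgebra.mem_toSubmodule]
  induction hy using LieSubmodule.lieSpan_induction with
  | mem s hs =>
    rcases hs with ⟨i, j, n, -, -, -, rfl⟩ | ⟨i, j, -, -, rfl⟩
    · exact hpow i j n
    · exact N.lie_mem (he i) (he j)
  | zero => exact zero_mem _
  | add y z _ _ hy hz => exact add_mem hy hz
  | smul t y _ hy => exact N.smul_mem t hy
  | lie x y _ hy => exact N.lie_mem x.2 hy

/-- If a Lie algebra endomorphism scales each `e i` by `t`, the subalgebra generated by the `e i`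
is contained in the sum of the eigenspaces for positive powers of `t`. -/
lemma lieSpan_le_iSup_eigenspace (φ : L →ₗ⁅ℝ⁆ L) (e : I → L) (t : ℝ) (he : ∀ i, φ (e i) = t • e i) :
    (LieSubalgebra.lieSpan ℝ L (Set.range e)).toSubmodule ≤
      ⨆ μ ∈ {μ : ℝ | ∃ n : ℕ, μ = t ^ (n + 1)}, Module.End.eigenspace (φ : L →ₗ[ℝ] L) μ := by
  set P := ⨆ μ ∈ {μ : ℝ | ∃ n : ℕ, μ = t ^ (n + 1)}, Module.End.eigenspace (φ : L →ₗ[ℝ] L) μ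
  have hmem : ∀ (n : ℕ) (x : L), φ x = t ^ (n + 1) • x → x ∈ P := fun n x hx =>
    Submodule.mem_iSup_of_mem (t ^ (n + 1)) <| Submodule.mem_iSup_of_mem ⟨n, rfl⟩ <|
      Module.End.mem_eigenspace_iff.mpr hx
  have hle : ∀ q : Submodule ℝ L, (∀ (n : ℕ) (x : L), φ x = t ^ (n + 1) • x → x ∈ q) → P ≤ q := by
    intro q hq
    refine iSup₂_le ?_
    rintro _ ⟨n, rfl⟩ x hx
    exact hq n x (Module.End.mem_eigenspace_iff.mp hx)
  have hlie : ∀ x ∈ P, ∀ y ∈ P, ⁅x, y⁆ ∈ P := by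
    have key : ∀ (n : ℕ) (x : L), φ x = t ^ (n + 1) • x → ∀ y ∈ P, ⁅x, y⁆ ∈ P := by
      intro n x hx y hy
      refine hle (P.comap (LieAlgebra.ad ℝ L x : L →ₗ[ℝ] L)) (fun m z hz => ?_) hy
      refine hmem (n + m + 1) _ ?_
      rw [LieAlgebra.ad_apply, LieHom.map_lie, hx, hz, smul_lie, lie_smul, smul_smul, ← pow_add]
      congr 2
      ring
    intro x hx y hy
    refine neg_mem_iff.mp ?_
    rw [lie_skew]
    refine hle (P.comap (LieAlgebra.ad ℝ L y : L →ₗ[ℝ] L)) (fun n z hz => ?_) hx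
    rw [Submodule.mem_comap, LieAlgebra.ad_apply, ← lie_skew]
    exact neg_mem (key n z hz y hy)
  intro x hx
  rw [LieSubalgebra.mem_toSubmodule] at hx
  induction hx using LieSubalgebra.lieSpan_induction with
  | mem x hx =>
    obtain ⟨i, rfl⟩ := hx
    exact hmem 0 _ (by simpa using he i)
  | zero => exact zero_mem _
  | add y z _ _ hy hz => exact add_mem hy hz
  | smul t y _ hy => exact P.smul_mem t hy
  | lie x y _ _ hx hy => exact hlie x hx y hy

/-- Two families scaled by `2` and by `2⁻¹` generate subalgebras that meet trivially. -/
lemma disjoint_lieSpan_of_scaling (φ : L →ₗ⁅ℝ⁆ L) (e f : I → L)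
    (he : ∀ i, φ (e i) = (2 : ℝ) • e i) (hf : ∀ i, φ (f i) = (2⁻¹ : ℝ) • f i) :
    Disjoint (LieSubalgebra.lieSpan ℝ L (Set.range e)).toSubmodule
      (LieSubalgebra.lieSpan ℝ L (Set.range f)).toSubmodule := by
  refine Disjoint.mono (lieSpan_le_iSup_eigenspace φ e 2 he)
    (lieSpan_le_iSup_eigenspace φ f 2⁻¹ hf) ?_
  refine (Module.End.eigenspaces_iSupIndep (φ : L →ₗ[ℝ] L)).disjoint_biSup_biSup ?_
  rw [Set.disjoint_left]
  rintro _ ⟨n, rfl⟩ ⟨m, hm⟩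
  have h1 : (1 : ℝ) < 2 ^ (n + 1) := one_lt_pow₀ (by norm_num) (by simp)
  have h2 : (2⁻¹ : ℝ) ^ (m + 1) < 1 := pow_lt_one₀ (by norm_num) (by norm_num) (by simp)
  linarith

end ChevalleyGenerators

/-- The quotient map from the free Lie algebra onto `ĝ₀(A)`. -/
noncomputable def hatProj (I : Type) (A : I → I → ℝ) :
    FreeLieAlgebra ℝ (HatGen I) →ₗ⁅ℝ⁆ hatGZero I A where
  toFun x := LieSubmodule.Quotient.mk' (LieSubmodule.lieSpan ℝ _ (hatRels I A)) x
  map_add' _ _ := rfl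
  map_smul' _ _ := rfl
  map_lie' := rfl

lemma hatProj_of (I : Type) (A : I → I → ℝ) (x : HatGen I) :
    hatProj I A (of ℝ x) = hatGen I A x := rfl

lemma hatProj_eq_zero_iff {I : Type} {A : I → I → ℝ} {x : FreeLieAlgebra ℝ (HatGen I)} :
    hatProj I A x = 0 ↔ x ∈ LieSubmodule.lieSpan ℝ (FreeLieAlgebra ℝ (HatGen I)) (hatRels I A) :=
  LieSubmodule.Quotient.mk_eq_zero (N := LieSubmodule.lieSpan ℝ _ (hatRels I A))

lemma hatProj_surjective (I : Type) (A : I → I → ℝ) : Function.Surjective (hatProj I A) :=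
  LieSubmodule.Quotient.surjective_mk' (LieSubmodule.lieSpan ℝ _ (hatRels I A))

lemma hatProj_of_mem_hatRels {I : Type} {A : I → I → ℝ} {x : FreeLieAlgebra ℝ (HatGen I)}
    (hx : x ∈ hatRels I A) : hatProj I A x = 0 :=
  hatProj_eq_zero_iff.mpr (LieSubmodule.subset_lieSpan hx)

lemma isHatSystem_hat (I : Type) (A : I → I → ℝ) :
    IsHatSystem A (hatE I A) (hatF I A) (hatH I A) where
  lie_h_h i j k l := by
    have := hatProj_of_mem_hatRels (A := A) (Or.inl (Or.inl (Or.inl ⟨i, j, k, l, rfl⟩)))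
    rwa [LieHom.map_lie] at this
  lie_h_e i j k := by
    have := hatProj_of_mem_hatRels (A := A) (Or.inl (Or.inl (Or.inr ⟨i, j, k, rfl⟩)))
    rw [map_sub, LieHom.map_lie, map_smul] at this
    exact sub_eq_zero.mp this
  lie_h_f i j k := by
    have := hatProj_of_mem_hatRels (A := A) (Or.inl (Or.inr ⟨i, j, k, rfl⟩))
    rw [map_add, LieHom.map_lie, map_smul] at this
    exact eq_neg_of_add_eq_zero_left this
  lie_e_f i j := by
    have := hatProj_of_mem_hatRels (A := A) (Or.inr ⟨i, j, rfl⟩)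
    rw [map_sub, LieHom.map_lie] at this
    exact sub_eq_zero.mp this
  span_eq_top := by
    set S := LieSubalgebra.lieSpan ℝ (hatGZero I A) (Set.range (hatE I A) ∪ Set.range (hatF I A))
    have hE : ∀ i, hatE I A i ∈ S := fun i => LieSubalgebra.subset_lieSpan (Or.inl ⟨i, rfl⟩)
    have hF : ∀ i, hatF I A i ∈ S := fun i => LieSubalgebra.subset_lieSpan (Or.inr ⟨i, rfl⟩)
    have hmem : ∀ x, hatGen I A x ∈ S := by
      rintro (⟨i, j⟩ | i | i)
      · have := hatProj_of_mem_hatRels (A := A) (Or.inr ⟨i, j, rfl⟩)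
        rw [map_sub, LieHom.map_lie] at this
        rw [← hatProj_of, ← sub_eq_zero.mp this]
        exact S.lie_mem (hE i) (hF j)
      · exact hE i
      · exact hF i
    have hlift : S.incl.comp (lift ℝ fun x => (⟨hatGen I A x, hmem x⟩ : S)) = hatProj I A :=
      hom_ext fun x => by
        rw [LieHom.comp_apply, lift_of_apply]; rfl
    rw [eq_top_iff]
    intro x _
    obtain ⟨y, rfl⟩ := hatProj_surjective I A x
    rw [← hlift]
    exact Subtype.prop (lift ℝ (fun x => (⟨hatGen I A x, hmem x⟩ : S)) y)

/-- The universal property of `ĝ₀(A)`: a homomorphism out of the free Lie algebra that kills the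
defining relations factors through the quotient. -/
lemma exists_hatGZero_lift {I : Type} {A : I → I → ℝ} {L : Type*} [LieRing L] [LieAlgebra ℝ L]
    (ψ : FreeLieAlgebra ℝ (HatGen I) →ₗ⁅ℝ⁆ L) (hψ : ∀ x ∈ hatRels I A, ψ x = 0) :
    ∃ φ : hatGZero I A →ₗ⁅ℝ⁆ L, ∀ x, φ (hatProj I A x) = ψ x := by
  have hker : LinearMap.ker (hatProj I A : FreeLieAlgebra ℝ (HatGen I) →ₗ[ℝ] hatGZero I A) ≤
      LinearMap.ker (ψ : FreeLieAlgebra ℝ (HatGen I) →ₗ[ℝ] L) := by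
    intro x hx
    have hx' := hatProj_eq_zero_iff.mp (LinearMap.mem_ker.mp hx)
    have hle : LieSubmodule.lieSpan ℝ (FreeLieAlgebra ℝ (HatGen I)) (hatRels I A) ≤ ψ.ker :=
      LieSubmodule.lieSpan_le.mpr fun y hy => LieHom.mem_ker.mpr (hψ y hy)
    exact LieHom.mem_ker.mp (hle hx')
  have hsurj := hatProj_surjective I A
  have hwd : ∀ x y, hatProj I A x = hatProj I A y → ψ x = ψ y := by
    intro x y hxy
    have : x - y ∈ LinearMap.ker (hatProj I A : FreeLieAlgebra ℝ (HatGen I) →ₗ[ℝ] hatGZero I A) :=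
      LinearMap.mem_ker.mpr (by simpa [sub_eq_zero] using hxy)
    simpa [sub_eq_zero] using hker this
  have hs := Function.surjInv_eq hsurj
  refine ⟨{ toFun := fun x => ψ (Function.surjInv hsurj x), map_add' := ?_, map_smul' := ?_,
            map_lie' := ?_ }, fun x => hwd _ _ (hs _)⟩
  · intro x y
    rw [← map_add]
    exact hwd _ _ (by rw [map_add, hs, hs, hs])
  · intro t x
    rw [RingHom.id_apply, ← map_smul]
    exact hwd _ _ (by rw [map_smul, hs, hs])
  · intro x y
    rw [← LieHom.map_lie]
    exact hwd _ _ (by rw [LieHom.map_lie, hs, hs, hs])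

/-- The endomorphism of `ĝ₀(A)` that scales `e i` by `2` and `f i` by `2⁻¹`. -/
lemma exists_hat_scaling (I : Type) (A : I → I → ℝ) :
    ∃ φ : hatGZero I A →ₗ⁅ℝ⁆ hatGZero I A,
      (∀ i, φ (hatE I A i) = (2 : ℝ) • hatE I A i) ∧
        ∀ i, φ (hatF I A i) = (2⁻¹ : ℝ) • hatF I A i := by
  have H := isHatSystem_hat I A
  let ψ := lift ℝ (L := hatGZero I A) fun x : HatGen I => match x with
    | .h i j => hatH I A i j
    | .e i => (2 : ℝ) • hatE I A i
    | .f i => (2⁻¹ : ℝ) • hatF I A i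
  have hh : ∀ i j, ψ (of ℝ (.h i j)) = hatH I A i j := fun i j => lift_of_apply ..
  have he : ∀ i, ψ (of ℝ (.e i)) = (2 : ℝ) • hatE I A i := fun i => lift_of_apply ..
  have hf : ∀ i, ψ (of ℝ (.f i)) = (2⁻¹ : ℝ) • hatF I A i := fun i => lift_of_apply ..
  obtain ⟨φ, hφ⟩ := exists_hatGZero_lift (A := A) ψ (by
    rintro _ (((⟨i, j, k, l, rfl⟩ | ⟨i, j, k, rfl⟩) | ⟨i, j, k, rfl⟩) | ⟨i, j, rfl⟩)
    · rw [LieHom.map_lie, hh, hh, H.lie_h_h]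
    · rw [map_sub, LieHom.map_lie, map_smul, hh, he, lie_smul, H.lie_h_e,
        smul_comm, sub_self]
    · rw [map_add, LieHom.map_lie, map_smul, hh, hf, lie_smul, H.lie_h_f,
        smul_neg, smul_comm, neg_add_cancel]
    · rw [map_sub, LieHom.map_lie, hh, he, hf, smul_lie, lie_smul, H.lie_e_f, smul_smul]
      norm_num)
  exact ⟨φ, fun i => (hφ _).trans (he i), fun i => (hφ _).trans (hf i)⟩

theorem kHat_ideals (I : Type) [Countable I] (A : I → I → ℝ)
    (hC1 : ∀ i j, A i j = A j i)
    (hC2 : ∀ i j, i ≠ j → A i j ≤ 0)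
    (hC3 : ∀ i j, 0 < A i i → ∃ m : ℤ, (m : ℝ) = 2 * A i j / A i i) :
    -- `k̂₀⁺` is an ideal of `ĝ₀(A)`
    (∀ x : hatGZero I A, ∀ y ∈ kHatPlus I A, ⁅x, y⁆ ∈ kHatPlus I A) ∧
    -- `k̂₀⁻` is an ideal of `ĝ₀(A)`
    (∀ x : hatGZero I A, ∀ y ∈ kHatMinus I A, ⁅x, y⁆ ∈ kHatMinus I A) ∧
    -- the sum `k̂₀ = k̂₀⁺ ⊕ k̂₀⁻` is direct and is an ideal of `ĝ₀(A)`
    Disjoint (kHatPlus I A : Submodule ℝ (hatGZero I A))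
      (kHatMinus I A : Submodule ℝ (hatGZero I A)) ∧
    (∀ x : hatGZero I A,
      ∀ y ∈ (kHatPlus I A : Submodule ℝ (hatGZero I A)) ⊔
            (kHatMinus I A : Submodule ℝ (hatGZero I A)),
      ⁅x, y⁆ ∈ (kHatPlus I A : Submodule ℝ (hatGZero I A)) ⊔
               (kHatMinus I A : Submodule ℝ (hatGZero I A))) := by
  have H := isHatSystem_hat I A
  have hplus : ∀ x : hatGZero I A, ∀ y ∈ kHatPlus I A, ⁅x, y⁆ ∈ kHatPlus I A :=
    H.lie_mem_lieSpan_serreElements hC1 hC2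
  have hminus : ∀ x : hatGZero I A, ∀ y ∈ kHatMinus I A, ⁅x, y⁆ ∈ kHatMinus I A :=
    H.swap.lie_mem_lieSpan_serreElements hC1 hC2
  refine ⟨hplus, hminus, ?_, ?_⟩
  · obtain ⟨φ, he, hf⟩ := exists_hat_scaling I A
    exact (disjoint_lieSpan_of_scaling φ _ _ he hf).mono (lieSpan_serreElements_le A (hatE I A))
      (lieSpan_serreElements_le A (hatF I A))
  · intro x y hy
    obtain ⟨u, hu, v, hv, rfl⟩ := Submodule.mem_sup.mp hy
    rw [lie_add]
    exact Submodule.add_mem_sup (hplus x u hu) (hminus x v hv)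
end

section
/- Let I be an at most countable index set and A = (a_{ij})_{i,j∈I} a real matrix satisfying conditions C1–C3. Let ĝ(A) be the quotient of ĝ_0(A) by the ideal k̂_0 generated by the elements d^±_{ij} (i ≠ j, a_{ii} > 0) and the elements [e_i,e_j], [f_i,f_j] with a_{ij} = 0, and let c ⊂ ĝ(A) be the span of the images of the h_{ij} with i ≠ j. Then c is a central ideal of ĝ(A), and the quotient ĝ(A)/c is isomorphic as a Lie algebra to the generalized Kac–Moody algebra g(A), via the map sending e_i ↦ e_i, f_i ↦ f_i, h_{ii} ↦ h_i. -/
/-!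
Statement 6: the span `c` of the `h i j` with `i ≠ j` is a central ideal of the
universal generalized Kac-Moody algebra `ĝ(A)`, and `ĝ(A)/c ≅ g(A)` via the map
sending generators to generators.
-/


open FreeLieAlgebra
open scoped Classical

/-- The generators of `g₀(A)`: `h i`, `e i`, `f i` for `i ∈ I`. -/
inductive GKMGen (I : Type) : Type
  | h (i : I)
  | e (i : I)
  | f (i : I)

variable (I : Type) (A : I → I → ℝ)

/-- The defining relation elements (R1)-(R4) inside the free Lie algebra. -/
def gkmRels : Set (FreeLieAlgebra ℝ (GKMGen I)) :=
  {x | ∃ i j : I, x = ⁅of ℝ (GKMGen.h i), of ℝ (GKMGen.h j)⁆} ∪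
  {x | ∃ i k : I, x = ⁅of ℝ (GKMGen.h i), of ℝ (GKMGen.e k)⁆ - A i k • of ℝ (GKMGen.e k)} ∪
  {x | ∃ i k : I, x = ⁅of ℝ (GKMGen.h i), of ℝ (GKMGen.f k)⁆ + A i k • of ℝ (GKMGen.f k)} ∪
  {x | ∃ i j : I, x = ⁅of ℝ (GKMGen.e i), of ℝ (GKMGen.f j)⁆ -
      (if i = j then of ℝ (GKMGen.h i) else 0)}

/-- `g₀(A)`, the quotient of the free Lie algebra by the ideal generated by the relations. -/
def gZero := FreeLieAlgebra ℝ (GKMGen I) ⧸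
  LieSubmodule.lieSpan ℝ (FreeLieAlgebra ℝ (GKMGen I)) (gkmRels I A)

noncomputable instance : LieRing (gZero I A) := by unfold gZero; infer_instance
noncomputable instance : LieAlgebra ℝ (gZero I A) := by unfold gZero; infer_instance

/-- The image of a free generator in `g₀(A)`. -/
noncomputable def gen (x : GKMGen I) : gZero I A :=
  LieSubmodule.Quotient.mk' _ (of ℝ x)

noncomputable def Egen (i : I) : gZero I A := gen I A (GKMGen.e i)
noncomputable def Fgen (i : I) : gZero I A := gen I A (GKMGen.f i)
noncomputable def Hgen (i : I) : gZero I A := gen I A (GKMGen.h i)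


variable (I : Type) (A : I → I → ℝ)

/-- The full set of GKM relations in `g₀(A)`, generating the ideal `k₀`. -/
noncomputable def kZeroGens : Set (gZero I A) :=
  {x | ∃ i j : I, ∃ n : ℕ, i ≠ j ∧ 0 < A i i ∧ (n : ℝ) = 1 - 2 * A i j / A i i ∧
    x = ((LieAlgebra.ad ℝ (gZero I A) (Egen I A i)) ^ n) (Egen I A j)} ∪
  {x | ∃ i j : I, ∃ n : ℕ, i ≠ j ∧ 0 < A i i ∧ (n : ℝ) = 1 - 2 * A i j / A i i ∧
    x = ((LieAlgebra.ad ℝ (gZero I A) (Fgen I A i)) ^ n) (Fgen I A j)} ∪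
  {x | ∃ i j : I, i ≠ j ∧ A i j = 0 ∧ x = ⁅Egen I A i, Egen I A j⁆} ∪
  {x | ∃ i j : I, i ≠ j ∧ A i j = 0 ∧ x = ⁅Fgen I A i, Fgen I A j⁆}

/-- The generalized Kac-Moody algebra `g(A) = g₀(A)/k₀`. -/
noncomputable def gkm := gZero I A ⧸ LieSubmodule.lieSpan ℝ (gZero I A) (kZeroGens I A)

noncomputable instance : LieRing (gkm I A) := by unfold gkm; infer_instance
noncomputable instance : LieAlgebra ℝ (gkm I A) := by unfold gkm; infer_instance

noncomputable def gkmE (i : I) : gkm I A := LieSubmodule.Quotient.mk' _ (Egen I A i)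
noncomputable def gkmF (i : I) : gkm I A := LieSubmodule.Quotient.mk' _ (Fgen I A i)
noncomputable def gkmH (i : I) : gkm I A := LieSubmodule.Quotient.mk' _ (Hgen I A i)

/-- The corresponding set of Serre-type relations in `ĝ₀(A)`, generating `k̂₀`. -/
noncomputable def kHatGens : Set (hatGZero I A) :=
  {x | ∃ i j : I, ∃ n : ℕ, i ≠ j ∧ 0 < A i i ∧ (n : ℝ) = 1 - 2 * A i j / A i i ∧
    x = ((LieAlgebra.ad ℝ (hatGZero I A) (hatE I A i)) ^ n) (hatE I A j)} ∪
  {x | ∃ i j : I, ∃ n : ℕ, i ≠ j ∧ 0 < A i i ∧ (n : ℝ) = 1 - 2 * A i j / A i i ∧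
    x = ((LieAlgebra.ad ℝ (hatGZero I A) (hatF I A i)) ^ n) (hatF I A j)} ∪
  {x | ∃ i j : I, i ≠ j ∧ A i j = 0 ∧ x = ⁅hatE I A i, hatE I A j⁆} ∪
  {x | ∃ i j : I, i ≠ j ∧ A i j = 0 ∧ x = ⁅hatF I A i, hatF I A j⁆}

/-- The universal generalized Kac-Moody algebra `ĝ(A) = ĝ₀(A)/k̂₀`. -/
noncomputable def gkmHat := hatGZero I A ⧸
  LieSubmodule.lieSpan ℝ (hatGZero I A) (kHatGens I A)

noncomputable instance : LieRing (gkmHat I A) := by unfold gkmHat; infer_instance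
noncomputable instance : LieAlgebra ℝ (gkmHat I A) := by unfold gkmHat; infer_instance

noncomputable def gkmHatE (i : I) : gkmHat I A := LieSubmodule.Quotient.mk' _ (hatE I A i)
noncomputable def gkmHatF (i : I) : gkmHat I A := LieSubmodule.Quotient.mk' _ (hatF I A i)
noncomputable def gkmHatH (i j : I) : gkmHat I A :=
  LieSubmodule.Quotient.mk' _ (hatH I A i j)

/-- The ideal `c` of `ĝ(A)` generated by the `h i j` with `i ≠ j`. -/
noncomputable def cIdeal : LieIdeal ℝ (gkmHat I A) :=
  LieSubmodule.lieSpan ℝ _ {x | ∃ i j : I, i ≠ j ∧ x = gkmHatH I A i j}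

section QuotientByIdeal

variable {R L L' : Type*} [CommRing R] [LieRing L] [LieAlgebra R L] [LieRing L'] [LieAlgebra R L']

/-- The quotient map of a Lie algebra by an ideal, as a morphism of Lie algebras. -/
def LieIdeal.quotientMk (N : LieIdeal R L) : L →ₗ⁅R⁆ L ⧸ N :=
  { N.toSubmodule.mkQ with map_lie' := fun {_ _} => rfl }

theorem LieIdeal.quotientMk_surjective (N : LieIdeal R L) : Function.Surjective N.quotientMk :=
  Submodule.mkQ_surjective N.toSubmodule

theorem LieIdeal.quotientMk_eq_zero {N : LieIdeal R L} {x : L} : N.quotientMk x = 0 ↔ x ∈ N :=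
  Submodule.Quotient.mk_eq_zero N.toSubmodule

/-- A morphism of Lie algebras that vanishes on an ideal factors through the quotient. -/
def LieIdeal.quotientLift (N : LieIdeal R L) (φ : L →ₗ⁅R⁆ L') (h : ∀ x ∈ N, φ x = 0) :
    L ⧸ N →ₗ⁅R⁆ L' :=
  { N.toSubmodule.liftQ (φ : L →ₗ[R] L') h with
    map_lie' := by
      intro x y
      obtain ⟨x, rfl⟩ := N.quotientMk_surjective x
      obtain ⟨y, rfl⟩ := N.quotientMk_surjective y
      exact φ.map_lie x y }

theorem LieHom.eq_zero_of_mem_lieSpan (φ : L →ₗ⁅R⁆ L') {s : Set L} (h : ∀ x ∈ s, φ x = 0) :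
    ∀ x ∈ LieSubmodule.lieSpan R L s, φ x = 0 := fun _ hx =>
  φ.mem_ker.1 (LieSubmodule.lieSpan_le.2 (fun y hy => φ.mem_ker.2 (h y hy)) hx)

theorem LieHom.map_ad_pow (φ : L →ₗ⁅R⁆ L') (n : ℕ) (x y : L) :
    φ ((LieAlgebra.ad R L x ^ n) y) = (LieAlgebra.ad R L' (φ x) ^ n) (φ y) := by
  induction n with
  | zero => simp
  | succ n ih => simp [pow_succ', ih]

/-- The elements that commute with `x`. -/
def LieSubalgebra.commutant (R : Type*) {L : Type*} [CommRing R] [LieRing L] [LieAlgebra R L]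
    (x : L) : LieSubalgebra R L where
  carrier := {y | ⁅y, x⁆ = 0}
  add_mem' {y z} hy hz := by
    simp only [Set.mem_ofPred_eq] at hy hz ⊢
    rw [add_lie, hy, hz, add_zero]
  zero_mem' := zero_lie x
  smul_mem' c y hy := by
    simp only [Set.mem_ofPred_eq] at hy ⊢
    rw [smul_lie, hy, smul_zero]
  lie_mem' {y z} hy hz := by
    change ⁅y, x⁆ = 0 at hy
    change ⁅z, x⁆ = 0 at hz
    change ⁅⁅y, z⁆, x⁆ = 0
    rw [lie_lie, hy, hz, lie_zero, lie_zero, sub_zero]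

theorem FreeLieAlgebra.map_mem_of_map_of_mem {X : Type*} (φ : FreeLieAlgebra R X →ₗ⁅R⁆ L)
    (S : LieSubalgebra R L) (h : ∀ x, φ (of R x) ∈ S) (z : FreeLieAlgebra R X) : φ z ∈ S := by
  let ψ : FreeLieAlgebra R X →ₗ⁅R⁆ S := lift R fun x => ⟨φ (of R x), h x⟩
  have hψ : S.incl.comp ψ = φ := by
    ext x
    simp [ψ]
  rw [← hψ]
  exact (ψ z).2

end QuotientByIdeal

section Presentations

variable {I : Type} {A : I → I → ℝ}

/-- The quotient map onto `g₀(A)`. -/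
noncomputable def gZeroMk (I : Type) (A : I → I → ℝ) :
    FreeLieAlgebra ℝ (GKMGen I) →ₗ⁅ℝ⁆ gZero I A :=
  LieIdeal.quotientMk
    (LieSubmodule.lieSpan ℝ (FreeLieAlgebra ℝ (GKMGen I)) (gkmRels I A))

/-- The quotient map from `g₀(A)` onto `g(A)`. -/
noncomputable def gkmMk (I : Type) (A : I → I → ℝ) : gZero I A →ₗ⁅ℝ⁆ gkm I A :=
  LieIdeal.quotientMk (LieSubmodule.lieSpan ℝ (gZero I A) (kZeroGens I A))

/-- The quotient map onto `ĝ₀(A)`. -/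
noncomputable def hatGZeroMk (I : Type) (A : I → I → ℝ) :
    FreeLieAlgebra ℝ (HatGen I) →ₗ⁅ℝ⁆ hatGZero I A :=
  LieIdeal.quotientMk
    (LieSubmodule.lieSpan ℝ (FreeLieAlgebra ℝ (HatGen I)) (hatRels I A))

/-- The quotient map from `ĝ₀(A)` onto `ĝ(A)`. -/
noncomputable def gkmHatMk (I : Type) (A : I → I → ℝ) : hatGZero I A →ₗ⁅ℝ⁆ gkmHat I A :=
  LieIdeal.quotientMk (LieSubmodule.lieSpan ℝ (hatGZero I A) (kHatGens I A))

theorem gkmMk_surjective : Function.Surjective (gkmMk I A) :=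
  LieIdeal.quotientMk_surjective _

theorem gZeroMk_surjective : Function.Surjective (gZeroMk I A) :=
  LieIdeal.quotientMk_surjective _

theorem gkmHatMk_surjective : Function.Surjective (gkmHatMk I A) :=
  LieIdeal.quotientMk_surjective _

theorem hatGZeroMk_surjective : Function.Surjective (hatGZeroMk I A) :=
  LieIdeal.quotientMk_surjective _

theorem gZeroMk_eq_zero {x} (hx : x ∈ gkmRels I A) : gZeroMk I A x = 0 :=
  LieIdeal.quotientMk_eq_zero.2 (LieSubmodule.subset_lieSpan hx)

theorem gkmMk_eq_zero {x} (hx : x ∈ kZeroGens I A) : gkmMk I A x = 0 :=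
  LieIdeal.quotientMk_eq_zero.2 (LieSubmodule.subset_lieSpan hx)

theorem hatGZeroMk_eq_zero {x} (hx : x ∈ hatRels I A) : hatGZeroMk I A x = 0 :=
  LieIdeal.quotientMk_eq_zero.2 (LieSubmodule.subset_lieSpan hx)

theorem gkmHatMk_eq_zero {x} (hx : x ∈ kHatGens I A) : gkmHatMk I A x = 0 :=
  LieIdeal.quotientMk_eq_zero.2 (LieSubmodule.subset_lieSpan hx)

/-- The Serre-type relations of `g(A)` and `ĝ(A)` for a family `u` of elements of a Lie
algebra. -/
def SerreRelations {L : Type*} [LieRing L] [LieAlgebra ℝ L] (A : I → I → ℝ) (u : I → L) : Prop :=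
  (∀ i j : I, ∀ n : ℕ, i ≠ j → 0 < A i i → (n : ℝ) = 1 - 2 * A i j / A i i →
    (LieAlgebra.ad ℝ L (u i) ^ n) (u j) = 0) ∧
  ∀ i j : I, i ≠ j → A i j = 0 → ⁅u i, u j⁆ = 0

theorem SerreRelations.map {L L' : Type*} [LieRing L] [LieAlgebra ℝ L] [LieRing L']
    [LieAlgebra ℝ L'] {u : I → L} (hu : SerreRelations A u) (φ : L →ₗ⁅ℝ⁆ L') :
    SerreRelations A fun i => φ (u i) :=
  ⟨fun i j n hij hi hn => by rw [← φ.map_ad_pow, hu.1 i j n hij hi hn, map_zero],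
    fun i j hij h => by rw [← φ.map_lie, hu.2 i j hij h, map_zero]⟩

theorem serreRelations_gkmE : SerreRelations A (gkmE I A) := by
  constructor
  · intro i j n hij hi hn
    exact ((gkmMk I A).map_ad_pow n (Egen I A i) (Egen I A j)).symm.trans
      (gkmMk_eq_zero (.inl (.inl (.inl ⟨i, j, n, hij, hi, hn, rfl⟩))))
  · intro i j hij h
    exact ((gkmMk I A).map_lie (Egen I A i) (Egen I A j)).symm.trans
      (gkmMk_eq_zero (.inl (.inr ⟨i, j, hij, h, rfl⟩)))

theorem serreRelations_gkmF : SerreRelations A (gkmF I A) := by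
  constructor
  · intro i j n hij hi hn
    exact ((gkmMk I A).map_ad_pow n (Fgen I A i) (Fgen I A j)).symm.trans
      (gkmMk_eq_zero (.inl (.inl (.inr ⟨i, j, n, hij, hi, hn, rfl⟩))))
  · intro i j hij h
    exact ((gkmMk I A).map_lie (Fgen I A i) (Fgen I A j)).symm.trans
      (gkmMk_eq_zero (.inr ⟨i, j, hij, h, rfl⟩))

theorem serreRelations_gkmHatE : SerreRelations A (gkmHatE I A) := by
  constructor
  · intro i j n hij hi hn
    exact ((gkmHatMk I A).map_ad_pow n (hatE I A i) (hatE I A j)).symm.trans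
      (gkmHatMk_eq_zero (.inl (.inl (.inl ⟨i, j, n, hij, hi, hn, rfl⟩))))
  · intro i j hij h
    exact ((gkmHatMk I A).map_lie (hatE I A i) (hatE I A j)).symm.trans
      (gkmHatMk_eq_zero (.inl (.inr ⟨i, j, hij, h, rfl⟩)))

theorem serreRelations_gkmHatF : SerreRelations A (gkmHatF I A) := by
  constructor
  · intro i j n hij hi hn
    exact ((gkmHatMk I A).map_ad_pow n (hatF I A i) (hatF I A j)).symm.trans
      (gkmHatMk_eq_zero (.inl (.inl (.inr ⟨i, j, n, hij, hi, hn, rfl⟩))))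
  · intro i j hij h
    exact ((gkmHatMk I A).map_lie (hatF I A i) (hatF I A j)).symm.trans
      (gkmHatMk_eq_zero (.inr ⟨i, j, hij, h, rfl⟩))

/-- The composite quotient map onto `g(A)`. -/
noncomputable def freeToGkm (I : Type) (A : I → I → ℝ) :
    FreeLieAlgebra ℝ (GKMGen I) →ₗ⁅ℝ⁆ gkm I A :=
  (gkmMk I A).comp (gZeroMk I A)

theorem freeToGkm_eq_zero {x} (hx : x ∈ gkmRels I A) : freeToGkm I A x = 0 := by
  rw [freeToGkm, LieHom.comp_apply, gZeroMk_eq_zero hx, map_zero]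

theorem freeToGkm_surjective : Function.Surjective (freeToGkm I A) :=
  gkmMk_surjective.comp gZeroMk_surjective

theorem freeToGkm_e (i : I) : freeToGkm I A (of ℝ (GKMGen.e i)) = gkmE I A i := rfl

theorem freeToGkm_f (i : I) : freeToGkm I A (of ℝ (GKMGen.f i)) = gkmF I A i := rfl

theorem freeToGkm_h (i : I) : freeToGkm I A (of ℝ (GKMGen.h i)) = gkmH I A i := rfl

/-- The composite quotient map onto `ĝ(A)`. -/
noncomputable def freeToGkmHat (I : Type) (A : I → I → ℝ) :
    FreeLieAlgebra ℝ (HatGen I) →ₗ⁅ℝ⁆ gkmHat I A :=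
  (gkmHatMk I A).comp (hatGZeroMk I A)

theorem freeToGkmHat_eq_zero {x} (hx : x ∈ hatRels I A) : freeToGkmHat I A x = 0 := by
  rw [freeToGkmHat, LieHom.comp_apply, hatGZeroMk_eq_zero hx, map_zero]

theorem freeToGkmHat_surjective : Function.Surjective (freeToGkmHat I A) :=
  gkmHatMk_surjective.comp hatGZeroMk_surjective

theorem freeToGkmHat_e (i : I) : freeToGkmHat I A (of ℝ (HatGen.e i)) = gkmHatE I A i := rfl

theorem freeToGkmHat_f (i : I) : freeToGkmHat I A (of ℝ (HatGen.f i)) = gkmHatF I A i := rfl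

theorem freeToGkmHat_h (i j : I) : freeToGkmHat I A (of ℝ (HatGen.h i j)) = gkmHatH I A i j := rfl

theorem gkm_lie_h_h (i j : I) : ⁅gkmH I A i, gkmH I A j⁆ = 0 := by
  simpa [freeToGkm_h] using
    freeToGkm_eq_zero (A := A) (.inl (.inl (.inl ⟨i, j, rfl⟩)))

theorem gkm_lie_h_e (i k : I) : ⁅gkmH I A i, gkmE I A k⁆ = A i k • gkmE I A k := by
  simpa [freeToGkm_h, freeToGkm_e, sub_eq_zero] using
    freeToGkm_eq_zero (A := A) (.inl (.inl (.inr ⟨i, k, rfl⟩)))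

theorem gkm_lie_h_f (i k : I) : ⁅gkmH I A i, gkmF I A k⁆ = -(A i k • gkmF I A k) := by
  simpa [freeToGkm_h, freeToGkm_f, add_eq_zero_iff_eq_neg] using
    freeToGkm_eq_zero (A := A) (.inl (.inr ⟨i, k, rfl⟩))

theorem gkm_lie_e_f (i j : I) :
    ⁅gkmE I A i, gkmF I A j⁆ = if i = j then gkmH I A i else 0 := by
  simpa [freeToGkm_h, freeToGkm_e, freeToGkm_f, sub_eq_zero, apply_ite (freeToGkm I A)] using
    freeToGkm_eq_zero (A := A) (.inr ⟨i, j, rfl⟩)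

theorem gkmHat_lie_h_h (i j k l : I) : ⁅gkmHatH I A i j, gkmHatH I A k l⁆ = 0 := by
  simpa [freeToGkmHat_h] using
    freeToGkmHat_eq_zero (A := A) (.inl (.inl (.inl ⟨i, j, k, l, rfl⟩)))

theorem gkmHat_lie_h_e (i j k : I) :
    ⁅gkmHatH I A i j, gkmHatE I A k⁆ = (if i = j then A i k else 0) • gkmHatE I A k := by
  simpa only [map_sub, LieHom.map_lie, map_smul, freeToGkmHat_h, freeToGkmHat_e,
      sub_eq_zero] using
    freeToGkmHat_eq_zero (A := A) (.inl (.inl (.inr ⟨i, j, k, rfl⟩)))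

theorem gkmHat_lie_h_f (i j k : I) :
    ⁅gkmHatH I A i j, gkmHatF I A k⁆ = -((if i = j then A i k else 0) • gkmHatF I A k) := by
  simpa only [map_add, LieHom.map_lie, map_smul, freeToGkmHat_h, freeToGkmHat_f,
      add_eq_zero_iff_eq_neg] using
    freeToGkmHat_eq_zero (A := A) (.inl (.inr ⟨i, j, k, rfl⟩))

theorem gkmHat_lie_e_f (i j : I) : ⁅gkmHatE I A i, gkmHatF I A j⁆ = gkmHatH I A i j := by
  simpa [freeToGkmHat_h, freeToGkmHat_e, freeToGkmHat_f, sub_eq_zero] using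
    freeToGkmHat_eq_zero (A := A) (.inr ⟨i, j, rfl⟩)

section UniversalProperty

variable {L : Type*} [LieRing L] [LieAlgebra ℝ L]

theorem gkm_hom_ext {φ ψ : gkm I A →ₗ⁅ℝ⁆ L} (he : ∀ i, φ (gkmE I A i) = ψ (gkmE I A i))
    (hf : ∀ i, φ (gkmF I A i) = ψ (gkmF I A i)) (x : gkm I A) : φ x = ψ x := by
  have h : φ.comp (freeToGkm I A) = ψ.comp (freeToGkm I A) := by
    apply FreeLieAlgebra.hom_ext
    rintro (i | i | i)
    · have hi : gkmH I A i = ⁅gkmE I A i, gkmF I A i⁆ := by simp [gkm_lie_e_f]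
      simp only [LieHom.comp_apply, freeToGkm_h, hi, LieHom.map_lie, he, hf]
    · exact he i
    · exact hf i
  obtain ⟨y, rfl⟩ := freeToGkm_surjective x
  exact LieHom.congr_fun h y

theorem gkmHat_hom_ext {φ ψ : gkmHat I A →ₗ⁅ℝ⁆ L}
    (he : ∀ i, φ (gkmHatE I A i) = ψ (gkmHatE I A i))
    (hf : ∀ i, φ (gkmHatF I A i) = ψ (gkmHatF I A i)) (x : gkmHat I A) : φ x = ψ x := by
  have h : φ.comp (freeToGkmHat I A) = ψ.comp (freeToGkmHat I A) := by
    apply FreeLieAlgebra.hom_ext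
    rintro (⟨i, j⟩ | i | i)
    · simp only [LieHom.comp_apply, freeToGkmHat_h, ← gkmHat_lie_e_f, LieHom.map_lie, he, hf]
    · exact he i
    · exact hf i
  obtain ⟨y, rfl⟩ := freeToGkmHat_surjective x
  exact LieHom.congr_fun h y

theorem exists_gkm_lift {h e f : I → L} (hhh : ∀ i j, ⁅h i, h j⁆ = 0)
    (hhe : ∀ i k, ⁅h i, e k⁆ = A i k • e k) (hhf : ∀ i k, ⁅h i, f k⁆ = -(A i k • f k))
    (hef : ∀ i j, ⁅e i, f j⁆ = if i = j then h i else 0)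
    (he : SerreRelations A e) (hf : SerreRelations A f) :
    ∃ φ : gkm I A →ₗ⁅ℝ⁆ L, (∀ i, φ (gkmE I A i) = e i) ∧ (∀ i, φ (gkmF I A i) = f i) ∧
      ∀ i, φ (gkmH I A i) = h i := by
  let φ₀ : FreeLieAlgebra ℝ (GKMGen I) →ₗ⁅ℝ⁆ L := lift ℝ fun
    | .h i => h i
    | .e i => e i
    | .f i => f i
  have h₀ : ∀ x ∈ gkmRels I A, φ₀ x = 0 := by
    rintro x (((⟨i, j, rfl⟩ | ⟨i, j, rfl⟩) | ⟨i, j, rfl⟩) | ⟨i, j, rfl⟩)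
    · simp [φ₀, hhh]
    · simp [φ₀, hhe]
    · simp [φ₀, hhf]
    · simp [φ₀, hef, apply_ite (lift ℝ _)]
  let φ₁ : gZero I A →ₗ⁅ℝ⁆ L := LieIdeal.quotientLift
    (LieSubmodule.lieSpan ℝ (FreeLieAlgebra ℝ (GKMGen I)) (gkmRels I A)) φ₀
    (φ₀.eq_zero_of_mem_lieSpan h₀)
  have hφe (i) : φ₁ (Egen I A i) = e i := lift_of_apply _ _
  have hφf (i) : φ₁ (Fgen I A i) = f i := lift_of_apply _ _
  have hφh (i) : φ₁ (Hgen I A i) = h i := lift_of_apply _ _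
  have h₁ : ∀ x ∈ kZeroGens I A, φ₁ x = 0 := by
    rintro x (((⟨i, j, n, hij, hi, hn, rfl⟩ | ⟨i, j, n, hij, hi, hn, rfl⟩) |
      ⟨i, j, hij, h, rfl⟩) | ⟨i, j, hij, h, rfl⟩)
    · rw [LieHom.map_ad_pow, hφe, hφe, he.1 i j n hij hi hn]
    · rw [LieHom.map_ad_pow, hφf, hφf, hf.1 i j n hij hi hn]
    · rw [LieHom.map_lie, hφe, hφe, he.2 i j hij h]
    · rw [LieHom.map_lie, hφf, hφf, hf.2 i j hij h]
  exact ⟨LieIdeal.quotientLift (LieSubmodule.lieSpan ℝ (gZero I A) (kZeroGens I A)) φ₁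
    (φ₁.eq_zero_of_mem_lieSpan h₁), hφe, hφf, hφh⟩

theorem exists_gkmHat_lift {h : I → I → L} {e f : I → L}
    (hhh : ∀ i j k l, ⁅h i j, h k l⁆ = 0)
    (hhe : ∀ i j k, ⁅h i j, e k⁆ = (if i = j then A i k else 0) • e k)
    (hhf : ∀ i j k, ⁅h i j, f k⁆ = -((if i = j then A i k else 0) • f k))
    (hef : ∀ i j, ⁅e i, f j⁆ = h i j)
    (he : SerreRelations A e) (hf : SerreRelations A f) :
    ∃ φ : gkmHat I A →ₗ⁅ℝ⁆ L, (∀ i, φ (gkmHatE I A i) = e i) ∧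
      (∀ i, φ (gkmHatF I A i) = f i) ∧ ∀ i j, φ (gkmHatH I A i j) = h i j := by
  let φ₀ : FreeLieAlgebra ℝ (HatGen I) →ₗ⁅ℝ⁆ L := lift ℝ fun
    | .h i j => h i j
    | .e i => e i
    | .f i => f i
  have h₀ : ∀ x ∈ hatRels I A, φ₀ x = 0 := by
    rintro x (((⟨i, j, k, l, rfl⟩ | ⟨i, j, k, rfl⟩) | ⟨i, j, k, rfl⟩) | ⟨i, j, rfl⟩)
    · simp [φ₀, hhh]
    · simp only [φ₀, map_sub, LieHom.map_lie, map_smul, lift_of_apply, hhe, sub_self]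
    · simp only [φ₀, map_add, LieHom.map_lie, map_smul, lift_of_apply, hhf,
        neg_add_cancel]
    · simp [φ₀, hef]
  let φ₁ : hatGZero I A →ₗ⁅ℝ⁆ L := LieIdeal.quotientLift
    (LieSubmodule.lieSpan ℝ (FreeLieAlgebra ℝ (HatGen I)) (hatRels I A)) φ₀
    (φ₀.eq_zero_of_mem_lieSpan h₀)
  have hφe (i) : φ₁ (hatE I A i) = e i := lift_of_apply _ _
  have hφf (i) : φ₁ (hatF I A i) = f i := lift_of_apply _ _
  have hφh (i j) : φ₁ (hatH I A i j) = h i j := lift_of_apply _ _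
  have h₁ : ∀ x ∈ kHatGens I A, φ₁ x = 0 := by
    rintro x (((⟨i, j, n, hij, hi, hn, rfl⟩ | ⟨i, j, n, hij, hi, hn, rfl⟩) |
      ⟨i, j, hij, h, rfl⟩) | ⟨i, j, hij, h, rfl⟩)
    · rw [LieHom.map_ad_pow, hφe, hφe, he.1 i j n hij hi hn]
    · rw [LieHom.map_ad_pow, hφf, hφf, hf.1 i j n hij hi hn]
    · rw [LieHom.map_lie, hφe, hφe, he.2 i j hij h]
    · rw [LieHom.map_lie, hφf, hφf, hf.2 i j hij h]
  exact ⟨LieIdeal.quotientLift (LieSubmodule.lieSpan ℝ (hatGZero I A) (kHatGens I A)) φ₁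
    (φ₁.eq_zero_of_mem_lieSpan h₁), hφe, hφf, hφh⟩

end UniversalProperty

theorem gkmHatH_central {i j : I} (hij : i ≠ j) (y : gkmHat I A) : ⁅y, gkmHatH I A i j⁆ = 0 := by
  obtain ⟨z, rfl⟩ := freeToGkmHat_surjective y
  refine FreeLieAlgebra.map_mem_of_map_of_mem (freeToGkmHat I A)
    (LieSubalgebra.commutant ℝ (gkmHatH I A i j)) ?_ z
  rintro (⟨k, l⟩ | k | k)
  · exact gkmHat_lie_h_h k l i j
  · change ⁅gkmHatE I A k, gkmHatH I A i j⁆ = 0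
    rw [← lie_skew, gkmHat_lie_h_e, if_neg hij, zero_smul, neg_zero]
  · change ⁅gkmHatF I A k, gkmHatH I A i j⁆ = 0
    rw [← lie_skew, gkmHat_lie_h_f, if_neg hij, zero_smul, neg_zero, neg_zero]

theorem cIdeal_central {x : gkmHat I A} (hx : x ∈ cIdeal I A) (y : gkmHat I A) : ⁅y, x⁆ = 0 := by
  induction hx using LieSubmodule.lieSpan_induction generalizing y with
  | mem x hx =>
    obtain ⟨i, j, hij, rfl⟩ := hx
    exact gkmHatH_central hij y
  | zero => exact lie_zero y
  | add x z _ _ hx hz => rw [lie_add, hx, hz, add_zero]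
  | smul a x _ hx => rw [lie_smul, hx, smul_zero]
  | lie x z _ hz => rw [hz, lie_zero]

theorem cIdeal_eq_span : (cIdeal I A : Submodule ℝ (gkmHat I A)) =
    Submodule.span ℝ {x | ∃ i j : I, i ≠ j ∧ x = gkmHatH I A i j} := by
  apply le_antisymm
  · intro x hx
    change x ∈ cIdeal I A at hx
    induction hx using LieSubmodule.lieSpan_induction with
    | mem x hx => exact Submodule.subset_span hx
    | zero => exact Submodule.zero_mem _
    | add x z _ _ hx hz => exact Submodule.add_mem _ hx hz
    | smul a x _ hx => exact Submodule.smul_mem _ a hx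
    | lie y x hx _ =>
      rw [cIdeal_central hx y]
      exact Submodule.zero_mem _
  · exact Submodule.span_le.2 LieSubmodule.subset_lieSpan

theorem exists_quotient_cIdeal_equiv : ∃ e : (gkmHat I A ⧸ cIdeal I A) ≃ₗ⁅ℝ⁆ gkm I A,
    (∀ i, e ((cIdeal I A).quotientMk (gkmHatE I A i)) = gkmE I A i) ∧
    (∀ i, e ((cIdeal I A).quotientMk (gkmHatF I A i)) = gkmF I A i) ∧
    (∀ i, e ((cIdeal I A).quotientMk (gkmHatH I A i i)) = gkmH I A i) := by
  obtain ⟨φ₀, hφe, hφf, hφh⟩ := exists_gkmHat_lift (A := A) (L := gkm I A)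
    (h := fun i j => if i = j then gkmH I A i else 0) (e := gkmE I A) (f := gkmF I A)
    (by intro i j k l; split_ifs <;> simp [gkm_lie_h_h])
    (by intro i j k; split_ifs <;> simp [gkm_lie_h_e])
    (by intro i j k; split_ifs <;> simp [gkm_lie_h_f])
    gkm_lie_e_f serreRelations_gkmE serreRelations_gkmF
  let π := (cIdeal I A).quotientMk
  have hπh {i j : I} (hij : i ≠ j) : π (gkmHatH I A i j) = 0 :=
    LieIdeal.quotientMk_eq_zero.2 (LieSubmodule.subset_lieSpan ⟨i, j, hij, rfl⟩)
  obtain ⟨ψ, hψe, hψf, hψh⟩ := exists_gkm_lift (A := A)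
    (h := fun i => π (gkmHatH I A i i)) (e := fun i => π (gkmHatE I A i))
    (f := fun i => π (gkmHatF I A i))
    (by intro i j; rw [← LieHom.map_lie, gkmHat_lie_h_h, map_zero])
    (by intro i k; rw [← LieHom.map_lie, gkmHat_lie_h_e, if_pos rfl, map_smul])
    (by intro i k
        rw [← LieHom.map_lie, gkmHat_lie_h_f, if_pos rfl, map_neg, map_smul])
    (by intro i j
        rw [← LieHom.map_lie, gkmHat_lie_e_f]
        split_ifs with hij
        · rw [hij]
        · exact hπh hij)
    (serreRelations_gkmHatE.map π) (serreRelations_gkmHatF.map π)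
  let φ : (gkmHat I A ⧸ cIdeal I A) →ₗ⁅ℝ⁆ gkm I A := (cIdeal I A).quotientLift φ₀
    (φ₀.eq_zero_of_mem_lieSpan (by
      rintro x ⟨i, j, hij, rfl⟩
      rw [hφh, if_neg hij]))
  have hφπ (x) : φ (π x) = φ₀ x := rfl
  have hφψ (x) : φ (ψ x) = x := gkm_hom_ext (φ := φ.comp ψ) (ψ := LieHom.id)
    (fun i => by simp only [LieHom.comp_apply, hψe, hφπ, hφe, LieHom.id_apply])
    (fun i => by simp only [LieHom.comp_apply, hψf, hφπ, hφf, LieHom.id_apply]) x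
  have hψφ (x) : ψ (φ x) = x := by
    obtain ⟨y, rfl⟩ := (cIdeal I A).quotientMk_surjective x
    exact gkmHat_hom_ext (φ := ψ.comp φ₀) (ψ := π)
      (fun i => by simp only [LieHom.comp_apply, hψe, hφe])
      (fun i => by simp only [LieHom.comp_apply, hψf, hφf]) y
  exact ⟨{ φ with invFun := ψ, left_inv := hψφ, right_inv := hφψ }, hφe, hφf,
    fun i => (hφh i i).trans (if_pos rfl)⟩

end Presentations

theorem gkmHat_quotient_center_iso (I : Type) [Countable I] (A : I → I → ℝ)
    (hC1 : ∀ i j, A i j = A j i)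
    (hC2 : ∀ i j, i ≠ j → A i j ≤ 0)
    (hC3 : ∀ i j, 0 < A i i → ∃ m : ℤ, (m : ℝ) = 2 * A i j / A i i) :
    -- `c` is precisely the span of the `h i j`, `i ≠ j` ...
    (cIdeal I A : Submodule ℝ (gkmHat I A)) =
      Submodule.span ℝ {x | ∃ i j : I, i ≠ j ∧ x = gkmHatH I A i j} ∧
    -- ... and it is central
    (∀ x ∈ cIdeal I A, ∀ y : gkmHat I A, ⁅y, x⁆ = 0) ∧
    -- `ĝ(A)/c ≅ g(A)`, mapping generators to generators
    (∃ e : (gkmHat I A ⧸ cIdeal I A) ≃ₗ⁅ℝ⁆ gkm I A,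
      (∀ i, e (LieSubmodule.Quotient.mk' (cIdeal I A) (gkmHatE I A i)) = gkmE I A i) ∧
      (∀ i, e (LieSubmodule.Quotient.mk' (cIdeal I A) (gkmHatF I A i)) = gkmF I A i) ∧
      (∀ i, e (LieSubmodule.Quotient.mk' (cIdeal I A) (gkmHatH I A i i)) = gkmH I A i)) := by
  exact ⟨cIdeal_eq_span, fun _ hx y => cIdeal_central hx y, exists_quotient_cIdeal_equiv⟩
end
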